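/- arXiv:2211.07599 — 7 statements merged into one kernel-verified Lean document; each statement's English description precedes it below -/
import Mathlib

section
/- Let N ≥ 2 be an integer and let s be a real number. The integral ∫₀^∞ x^{-s/2}(1+x)^{s/2} Φ_N(x) dx is finite if and only if s < 4. -/
open MeasureTheory Set

/-- The 2-point intensity factor for zeros of degree-`N` random elliptic polynomials. -/
noncomputable def Phi (N : ℕ) (x : ℝ) : ℝ :=
  (((1+x)^N - 1 - N*x)^2 * (1+x)^(N-2) +
    ((1+x)^N - 1 - N*x*(1+x)^(N-1))^2) / ((1+x)^N - 1)^3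

lemma auxD_lower (n : ℕ) (x : ℝ) (hx : 0 < x) : x * (1+x)^n ≤ (1+x)^(n+1) - 1 := by
  have h : 1 ≤ (1+x)^n := one_le_pow₀ (by linarith)
  rw [pow_succ]; nlinarith

lemma auxD_upper (n : ℕ) (x : ℝ) (hx : 0 < x) :
    (1+x)^(n+1) - 1 ≤ (n+1) * x * (1+x)^n := by
  induction n with
  | zero => simp
  | succ n ih =>
    have h : 1 ≤ (1+x)^(n+1) := one_le_pow₀ (by linarith)
    have e1 : (1+x)^(n+1+1) - 1 = (1+x) * ((1+x)^(n+1) - 1) + x := by ring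
    have e2 : ((n+1 : ℕ) + 1 : ℝ) * x * (1+x)^(n+1)
        = (1+x) * ((n+1) * x * (1+x)^n) + x * (1+x)^(n+1) := by push_cast; ring
    rw [e1, e2]
    have h1 := mul_le_mul_of_nonneg_left ih (by linarith : 0 ≤ 1 + x)
    nlinarith

lemma auxA_lower (n : ℕ) (x : ℝ) (hx : 0 < x) :
    x^2 * (1+x)^n ≤ (1+x)^(n+2) - 1 - (n+2) * x := by
  induction n with
  | zero => simp; ring_nf; rfl
  | succ n ih =>
    have h : 0 ≤ x^2 * (1+x)^n := by positivity
    have h1 := mul_le_mul_of_nonneg_left (auxD_lower (n+1) x hx) hx.le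
    have e1 : (1+x)^(n+1+2) - 1 - ((n+1 : ℕ) + 2 : ℝ) * x
      = ((1+x)^(n+2) - 1 - (n+2) * x) + x * ((1+x)^(n+1+1) - 1) := by push_cast; ring
    have e2 : x^2 * (1+x)^(n+1) = x * (x * (1+x)^(n+1)) := by ring
    rw [e1, e2]; linarith

lemma auxStep (n : ℕ) (x : ℝ) (hx : 0 < x) :
    x * ((1+x)^(n+1+1) - 1) ≤ (n+2) * (x^2 * (1+x)^(n+1)) := by
  have h1 := mul_le_mul_of_nonneg_left (auxD_upper (n+1) x hx) hx.le
  refine h1.trans (le_of_eq ?_)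
  push_cast; ring

lemma auxA_upper (n : ℕ) (x : ℝ) (hx : 0 < x) :
    (1+x)^(n+2) - 1 - (n+2) * x ≤ (n+2)^2 * (x^2 * (1+x)^n) := by
  induction n with
  | zero => simp; nlinarith
  | succ n ih =>
    have e1 : (1+x)^(n+1+2) - 1 - ((n+1 : ℕ) + 2 : ℝ) * x
      = ((1+x)^(n+2) - 1 - (n+2) * x) + x * ((1+x)^(n+1+1) - 1) := by push_cast; ring
    have h1 := auxStep n x hx
    have h2 : x^2 * (1+x)^n ≤ x^2 * (1+x)^(n+1) := by
      gcongr <;> linarith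
    have h3 : (n+2 : ℝ)^2 * (x^2 * (1+x)^n) ≤ (n+2)^2 * (x^2 * (1+x)^(n+1)) := by gcongr
    have h4 : 0 ≤ x^2 * (1+x)^(n+1) := by positivity
    have h5 : 0 ≤ (n : ℝ) * (x^2 * (1+x)^(n+1)) := by positivity
    rw [e1]; push_cast; nlinarith

lemma auxB (n : ℕ) (x : ℝ) (hx : 0 < x) :
    0 ≤ (n+2) * x * (1+x)^(n+1) - ((1+x)^(n+2) - 1) ∧
    (n+2) * x * (1+x)^(n+1) - ((1+x)^(n+2) - 1) ≤ (n+2)^2 * (x^2 * (1+x)^n) := by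
  induction n with
  | zero => simp; constructor <;> nlinarith
  | succ n ih =>
    have e1 : ((n+1 : ℕ)+2 : ℝ) * x * (1+x)^(n+1+1) - ((1+x)^(n+1+2) - 1)
      = (1+x) * ((n+2) * x * (1+x)^(n+1) - ((1+x)^(n+2) - 1)) + x * ((1+x)^(n+1+1) - 1) := by
        push_cast; ring
    have h1 := auxStep n x hx
    have h0 : 0 ≤ x * ((1+x)^(n+1+1) - 1) :=
      mul_nonneg hx.le (sub_nonneg.2 (one_le_pow₀ (by linarith)))
    have h3 := mul_le_mul_of_nonneg_left ih.2 (by linarith : 0 ≤ 1 + x)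
    have h3' := mul_nonneg (by linarith : 0 ≤ 1 + x) ih.1
    have e2 : (1+x) * ((n+2 : ℝ)^2 * (x^2 * (1+x)^n)) = (n+2)^2 * (x^2 * (1+x)^(n+1)) := by ring
    have h4 : 0 ≤ x^2 * (1+x)^(n+1) := by positivity
    have h5 : 0 ≤ (n : ℝ) * (x^2 * (1+x)^(n+1)) := by positivity
    rw [e1]
    refine ⟨by linarith, ?_⟩
    rw [e2] at h3
    push_cast; nlinarith

lemma Phi_upper (n : ℕ) (x : ℝ) (hx : 0 < x) :
    Phi (n+2) x ≤ 2 * (n+2)^4 * (x * ((1+x)^3)⁻¹) := by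
  unfold Phi
  have hy : 0 < 1 + x := by linarith
  have hD := auxD_lower (n+1) x hx
  have hA := auxA_upper n x hx
  have hA' : 0 ≤ (1+x)^(n+2) - 1 - (n+2) * x := le_trans (by positivity) (auxA_lower n x hx)
  obtain ⟨hB', hB⟩ := auxB n x hx
  have hone : 1 ≤ (1+x)^n := one_le_pow₀ (by linarith)
  have hnum : (((1+x)^(n+2) - 1 - (n+2)*x)^2 * (1+x)^n +
    ((n+2) * x * (1+x)^(n+1) - ((1+x)^(n+2) - 1))^2) ≤ 2 * (n+2)^4 * x^4 * ((1+x)^n)^3 := by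
    have h1 := pow_le_pow_left₀ hA' hA 2
    have h2 := pow_le_pow_left₀ hB' hB 2
    have h3 := mul_le_mul_of_nonneg_right h1 (by positivity : 0 ≤ (1+x)^n)
    have h4 : ((n+2 : ℝ)^2 * (x^2 * (1+x)^n))^2 * 1 ≤ ((n+2 : ℝ)^2 * (x^2 * (1+x)^n))^2 * (1+x)^n := by
      gcongr
    nlinarith
  have hden : (x * (1+x)^(n+1))^3 ≤ ((1+x)^(n+2) - 1)^3 :=
    pow_le_pow_left₀ (by positivity) hD 3
  have hpos : 0 < (x * (1+x)^(n+1))^3 := by positivity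
  have e : 2 * (n+2 : ℝ)^4 * (x * ((1+x)^3)⁻¹) =
      (2 * (n+2)^4 * x^4 * ((1+x)^n)^3) / (x * (1+x)^(n+1))^3 := by
    field_simp; ring
  rw [e]
  refine div_le_div₀ (by positivity) ?_ hpos hden
  refine le_trans (le_of_eq ?_) hnum
  simp only [Nat.add_sub_cancel, show n + 2 - 1 = n + 1 by omega]
  push_cast; ring

lemma Phi_lower (n : ℕ) (x : ℝ) (hx : 0 < x) :
    x * ((1+x)^3)⁻¹ ≤ (n+2)^3 * Phi (n+2) x := by
  unfold Phi
  have hy : 0 < 1 + x := by linarith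
  have hD := auxD_upper (n+1) x hx
  have hA := auxA_lower n x hx
  have hDp : 0 < (1+x)^(n+2) - 1 := lt_of_lt_of_le (by positivity) (auxD_lower (n+1) x hx)
  have hden : ((1+x)^(n+2) - 1)^3 ≤ (((n+1:ℕ)+1) * x * (1+x)^(n+1))^3 :=
    pow_le_pow_left₀ hDp.le hD 3
  have h1 := pow_le_pow_left₀ (by positivity) hA 2
  have h3 := mul_le_mul_of_nonneg_right h1 (by positivity : 0 ≤ (1+x)^n)
  rw [← mul_div_assoc, le_div_iff₀ (by positivity)]
  have h4 := mul_le_mul_of_nonneg_left hden (by positivity : 0 ≤ x * ((1+x)^3)⁻¹)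
  refine h4.trans ?_
  have e : x * ((1+x)^3)⁻¹ * (((n+1:ℕ)+1) * x * (1+x)^(n+1))^3
      = (n+2 : ℝ)^3 * ((x^2 * (1+x)^n)^2 * (1+x)^n) := by
    push_cast; field_simp; ring
  rw [e]
  simp only [Nat.add_sub_cancel]
  push_cast
  gcongr
  refine h3.trans (le_add_of_nonneg_right (by positivity))

lemma Phi_nonneg' (n : ℕ) (x : ℝ) (hx : 0 < x) : 0 ≤ Phi (n+2) x := by
  have h := Phi_lower n x hx
  have h1 : 0 ≤ x * ((1+x)^3)⁻¹ := by positivity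
  exact nonneg_of_mul_nonneg_right (h1.trans h) (by positivity)

lemma weight_eq (s x : ℝ) (hx : 0 < x) :
    x ^ (-s/2) * (1+x) ^ (s/2) * (x * ((1+x)^3)⁻¹) = x ^ (1 - s/2) * (1+x) ^ (s/2 - 3) := by
  have hy : 0 < 1 + x := by linarith
  rw [show (1 - s/2) = -s/2 + 1 by ring, Real.rpow_add_one hx.ne', Real.rpow_sub hy,
    show (3:ℝ) = ((3:ℕ):ℝ) by norm_num, Real.rpow_natCast]
  field_simp

lemma g_integrable (s : ℝ) (hs : s < 4) :
    IntegrableOn (fun x : ℝ => x ^ (1 - s/2) * (1+x) ^ (s/2 - 3)) (Ioi 0) := by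
  have hm : Measurable (fun x : ℝ => x ^ (1 - s/2) * (1+x) ^ (s/2 - 3)) := by fun_prop
  rw [← Ioc_union_Ioi_eq_Ioi (zero_le_one (α := ℝ))]
  refine IntegrableOn.union ?_ ?_
  · have h : IntegrableOn (fun x : ℝ => x ^ (1 - s/2)) (Ioc 0 1) :=
      (intervalIntegrable_iff_integrableOn_Ioc_of_le zero_le_one).1
        (intervalIntegral.intervalIntegrable_rpow' (by linarith))
    refine Integrable.mono' h hm.aestronglyMeasurable ?_
    refine (ae_restrict_mem measurableSet_Ioc).mono fun x hx => ?_
    have hx0 : 0 < x := hx.1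
    rw [Real.norm_of_nonneg (by positivity)]
    exact mul_le_of_le_one_right (by positivity)
      (Real.rpow_le_one_of_one_le_of_nonpos (by linarith) (by linarith))
  · have h : IntegrableOn (fun x : ℝ => x ^ (-2 : ℝ)) (Ioi 1) :=
      integrableOn_Ioi_rpow_of_lt (by norm_num) one_pos
    refine Integrable.mono' h hm.aestronglyMeasurable ?_
    refine (ae_restrict_mem measurableSet_Ioi).mono fun x hx => ?_
    have hx0 : 0 < x := one_pos.trans hx
    rw [Real.norm_of_nonneg (by positivity), show (-2:ℝ) = (1 - s/2) + (s/2 - 3) by ring,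
      Real.rpow_add hx0]
    gcongr ?_ * ?_
    exact Real.rpow_le_rpow_of_nonpos hx0 (by linarith) (by linarith)

lemma g_not_integrable (s : ℝ) (hs : 4 ≤ s) :
    ¬ IntegrableOn (fun x : ℝ => x ^ (1 - s/2) * (1+x) ^ (s/2 - 3)) (Ioi 0) := by
  intro hg
  have h1 : IntegrableOn (fun x : ℝ => 2 * (x ^ (1 - s/2) * (1+x) ^ (s/2 - 3))) (Ioo 0 1) :=
    (hg.mono_set Ioo_subset_Ioi_self).const_mul 2
  have h2 : IntegrableOn (fun x : ℝ => x ^ (-1 : ℝ)) (Ioo 0 1) := by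
    have hm : Measurable (fun x : ℝ => x ^ (-1 : ℝ)) := by fun_prop
    refine Integrable.mono' h1 hm.aestronglyMeasurable ?_
    refine (ae_restrict_mem measurableSet_Ioo).mono fun x hx => ?_
    have hx0 : 0 < x := hx.1
    have hx1 := hx.2
    rw [Real.norm_of_nonneg (by positivity)]
    have a : x ^ (-1 : ℝ) ≤ x ^ (1 - s/2) :=
      Real.rpow_le_rpow_of_exponent_ge hx0 hx1.le (by linarith)
    have b : (1+x) ^ (-1 : ℝ) ≤ (1+x) ^ (s/2 - 3) :=
      Real.rpow_le_rpow_of_exponent_le (by linarith) (by linarith)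
    have c : 1/2 ≤ (1+x) ^ (-1 : ℝ) := by
      rw [Real.rpow_neg_one, ← one_div]
      exact one_div_le_one_div_of_le (by linarith) (by linarith)
    have d : 0 ≤ x ^ (1 - s/2) := by positivity
    nlinarith [mul_le_mul_of_nonneg_left (c.trans b) d]
  rw [intervalIntegral.integrableOn_Ioo_rpow_iff one_pos] at h2
  exact lt_irrefl _ h2

/-- The integral `∫₀^∞ x^{-s/2}(1+x)^{s/2} Φ_N(x) dx` is finite iff `s < 4`. -/
theorem expected_riesz_energy_finite_iff (N : ℕ) (hN : 2 ≤ N) (s : ℝ) :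
    IntegrableOn (fun x : ℝ => x ^ (-s/2) * (1+x) ^ (s/2) * Phi N x) (Ioi 0) ↔ s < 4 := by
  obtain ⟨n, rfl⟩ := Nat.exists_eq_add_of_le' hN
  have hm : Measurable (fun x : ℝ => x ^ (-s/2) * (1+x) ^ (s/2) * Phi (n+2) x) := by
    unfold Phi; fun_prop
  have hm' : Measurable (fun x : ℝ => x ^ (1 - s/2) * (1+x) ^ (s/2 - 3)) := by fun_prop
  constructor
  · intro hf
    by_contra hs
    refine g_not_integrable s (not_lt.1 hs) ?_
    refine Integrable.mono' (Integrable.const_mul hf ((n+2 : ℝ)^3)) hm'.aestronglyMeasurable ?_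
    refine (ae_restrict_mem measurableSet_Ioi).mono fun x hx => ?_
    have hx0 : 0 < x := hx
    rw [Real.norm_of_nonneg (by positivity), ← weight_eq s x hx0, mul_left_comm ((n+2 : ℝ)^3)]
    exact mul_le_mul_of_nonneg_left (Phi_lower n x hx0) (by positivity)
  · intro hs
    refine Integrable.mono' (Integrable.const_mul (g_integrable s hs) (2 * (n+2 : ℝ)^4))
      hm.aestronglyMeasurable ?_
    refine (ae_restrict_mem measurableSet_Ioi).mono fun x hx => ?_
    have hx0 : 0 < x := hx
    have hP := Phi_nonneg' n x hx0
    rw [Real.norm_of_nonneg (by positivity), ← weight_eq s x hx0, mul_left_comm]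
    exact mul_le_mul_of_nonneg_left (Phi_upper n x hx0) (by positivity)
end

section
/- Let N ≥ 2 be an integer and let r < 0 be a real number. Then the series Σ_{k=1}^∞ Γ(Nk+1)/Γ(Nk+2−r) and Σ_{k=1}^∞ Γ(Nk)/Γ(Nk+2−r) converge, and ∫₀^∞ x^{-r}(1+x)^{r} Φ_N(x) dx = Γ(1−r)·[ 1/Γ(2−r) + r(1+r)·Σ_{k=1}^∞ Γ(Nk+1)/Γ(Nk+2−r) + r(1−r)·Σ_{k=1}^∞ Γ(Nk)/Γ(Nk+2−r) ]. -/
open MeasureTheory Set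

open Filter Topology

/-- The geometric sum `1 + u + ... + u^(N-1)`. -/
noncomputable def gsum (N : ℕ) (u : ℝ) : ℝ := ∑ i ∈ Finset.range N, u ^ i

lemma gsum_mul (N : ℕ) (u : ℝ) : (1 - u) * gsum N u = 1 - u ^ N := mul_neg_geom_sum u N

lemma gsum_pos {N : ℕ} (hN : 1 ≤ N) {u : ℝ} (hu : 0 ≤ u) : 0 < gsum N u := by
  unfold gsum
  obtain ⟨m, rfl⟩ : ∃ m, N = m + 1 := ⟨N - 1, by omega⟩
  rw [Finset.sum_range_succ']
  have : 0 ≤ ∑ i ∈ Finset.range m, u ^ (i + 1) := Finset.sum_nonneg fun i _ => by positivity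
  simp only [pow_zero]; linarith

lemma gsum_cont (N : ℕ) : Continuous (gsum N) := by unfold gsum; fun_prop

lemma beta_nat (n : ℕ) {t : ℝ} (ht : -1 < t) :
    ∫ u in (0:ℝ)..1, u ^ n * (1 - u) ^ t =
      Real.Gamma (n + 1) * Real.Gamma (t + 1) / Real.Gamma (n + t + 2) := by
  have h1 := ProbabilityTheory.beta_eq_betaIntegralReal (n + 1) (t + 1) (by positivity)
    (by linarith)
  unfold ProbabilityTheory.beta at h1
  rw [show (n:ℝ) + t + 2 = n + 1 + (t + 1) by ring, h1, Complex.betaIntegral]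
  have : ∫ x in (0:ℝ)..1, (x:ℂ) ^ (((n + 1 : ℝ) : ℂ) - 1) * (1 - (x:ℂ)) ^ (((t + 1 : ℝ):ℂ) - 1)
      = ∫ x in (0:ℝ)..1, ((x ^ n * (1 - x) ^ t : ℝ) : ℂ) := by
    apply intervalIntegral.integral_congr
    intro x hx
    rw [uIcc_of_le zero_le_one] at hx
    simp only
    rw [Complex.ofReal_mul, Complex.ofReal_cpow (by linarith [hx.2])]
    push_cast
    simp
  rw [this, intervalIntegral.integral_ofReal, Complex.ofReal_re]

lemma intble_rpow {t : ℝ} (ht : -1 < t) :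
    IntervalIntegrable (fun u : ℝ => (1 - u) ^ t) volume 0 1 := by
  have := (intervalIntegral.intervalIntegrable_rpow' (a := 1) (b := 0) ht).comp_sub_left 1
  simpa using this

lemma intble_term (c N : ℕ) (hN : 1 ≤ N) {t : ℝ} (ht : -1 < t) :
    IntervalIntegrable (fun u : ℝ => u ^ c / gsum N u * (1 - u) ^ t) volume 0 1 := by
  apply (intble_rpow ht).continuousOn_mul
  apply ContinuousOn.div (by fun_prop) (gsum_cont N).continuousOn
  intro x hx
  rw [uIcc_of_le zero_le_one] at hx
  exact (gsum_pos hN hx.1).ne'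

lemma hasSum_term (c N : ℕ) (hN : 1 ≤ N) {t : ℝ} (ht : 0 < t) :
    HasSum (fun k : ℕ => ∫ u in (0:ℝ)..1, u ^ (c + N * k) * (1 - u) ^ t)
      (∫ u in (0:ℝ)..1, u ^ c / gsum N u * (1 - u) ^ (t - 1)) := by
  have key : ∀ u : ℝ, 0 < u → u < 1 →
      HasSum (fun k : ℕ => u ^ (c + N * k) * (1 - u) ^ t)
        (u ^ c / gsum N u * (1 - u) ^ (t - 1)) := by
    intro u h0 h1
    have hq : u ^ N < 1 := pow_lt_one₀ h0.le h1 (by omega)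
    have := ((hasSum_geometric_of_lt_one (by positivity) hq).mul_left (u ^ c)).mul_right
      ((1 - u) ^ t)
    have e1 : (fun k : ℕ => u ^ (c + N * k) * (1 - u) ^ t)
        = fun k : ℕ => u ^ c * (u ^ N) ^ k * (1 - u) ^ t := by
      ext k; rw [pow_add, pow_mul]
    have e2 : u ^ c / gsum N u * (1 - u) ^ (t - 1) = u ^ c * (1 - u ^ N)⁻¹ * (1 - u) ^ t := by
      rw [← gsum_mul, Real.rpow_sub_one (by linarith)]
      have := gsum_pos hN h0.le
      have : 1 - u ≠ 0 := by linarith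
      field_simp
    rw [e1, e2]
    exact this
  have hne : ∀ᵐ u : ℝ, u ≠ 1 := by
    simp [ae_iff, measure_singleton]
  have key' : ∀ᵐ u : ℝ, u ∈ uIoc (0:ℝ) 1 → HasSum (fun k : ℕ => u ^ (c + N * k) * (1 - u) ^ t)
        (u ^ c / gsum N u * (1 - u) ^ (t - 1)) := by
    filter_upwards [hne] with u hu hm
    rw [uIoc_of_le zero_le_one] at hm
    exact key u hm.1 (lt_of_le_of_ne hm.2 hu)
  refine intervalIntegral.hasSum_integral_of_dominated_convergence
    (fun k u => u ^ (c + N * k) * (1 - u) ^ t) ?_ ?_ ?_ ?_ key'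
  · intro n
    apply Measurable.aestronglyMeasurable
    fun_prop
  · intro n
    refine Eventually.of_forall fun u hm => ?_
    rw [uIoc_of_le zero_le_one] at hm
    have h1 := hm.1
    rw [Real.norm_of_nonneg]
    have := Real.rpow_nonneg (sub_nonneg.2 hm.2) t
    positivity
  · filter_upwards [key'] with u hu hm using (hu hm).summable
  · apply (intble_term c N hN (t := t - 1) (by linarith)).congr_ae
    rw [EventuallyEq, ae_restrict_iff' measurableSet_uIoc]
    filter_upwards [key'] with u hu hm using (hu hm).tsum_eq.symm

/-- The integrand after summation, in the variable `u = 1/(1+x)`. -/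
noncomputable def Gf (m : ℕ) (s u : ℝ) : ℝ :=
  (1 - u) ^ s - s * (1 - s) * (u ^ (m+2) / gsum (m+2) u * (1 - u) ^ (s - 1))
    - s * (u ^ (m+1) / gsum (m+2) u * (1 - u) ^ (s + 1 - 1))

/-- The boundary term of the integration by parts. -/
noncomputable def Hf (m : ℕ) (s u : ℝ) : ℝ :=
  (1 - u) ^ s * (u ^ (m+1) * ((m+2) / gsum (m+2) u ^ 2 + (s - 1) * u / gsum (m+2) u
    - 1 / gsum (m+2) u))

lemma Gf_intble (m : ℕ) {s : ℝ} (hs : 0 < s) : IntervalIntegrable (Gf m s) volume 0 1 := by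
  unfold Gf
  exact ((intble_rpow (by linarith)).sub
    ((intble_term _ _ (by omega) (by linarith)).const_mul _)).sub
    ((intble_term _ _ (by omega) (by linarith)).const_mul _)

lemma Hf_cont (m : ℕ) {s : ℝ} (hs : 0 < s) : ContinuousOn (Hf m s) (Icc 0 1) := by
  have hg := (gsum_cont (m+2)).continuousOn (s := Icc 0 1)
  have hne : ∀ x ∈ Icc (0:ℝ) 1, gsum (m+2) x ≠ 0 := fun x hx => (gsum_pos (by omega) hx.1).ne'
  unfold Hf
  apply ContinuousOn.mul
  · exact ContinuousOn.rpow_const (by fun_prop) fun x _ => Or.inr hs.le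
  · apply ContinuousOn.mul (by fun_prop)
    apply ContinuousOn.sub
    · apply ContinuousOn.add
      · exact ContinuousOn.div (by fun_prop) (hg.pow 2) fun x hx => pow_ne_zero 2 (hne x hx)
      · exact ContinuousOn.div (by fun_prop) hg hne
    · exact ContinuousOn.div (by fun_prop) hg hne

lemma Hf_deriv (m : ℕ) (s : ℝ) {u : ℝ} (h0 : 0 < u) (h1 : u < 1) :
    HasDerivAt (Hf m s) ((1 - u) ^ s * (
      (u * (1 - u^(m+2)) - (m+2) * u^(m+2) * (1 - u))^2
        + u^(m+2) * ((1 - u^(m+2)) - (m+2) * (1 - u))^2) / ((1 - u^(m+2))^3 * u^2)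
      - Gf m s u) u := by
  have hq : u ^ (m+2) < 1 := pow_lt_one₀ h0.le h1 (by omega)
  have hq' : 1 - u ^ (m+2) ≠ 0 := by linarith
  have hu : u ≠ 0 := h0.ne'
  have hu1 : 1 - u ≠ 0 := by linarith
  have hS : ∀ v : ℝ, v < 1 → gsum (m+2) v = (1 - v^(m+2)) / (1 - v) := by
    intro v hv
    have : 1 - v ≠ 0 := by linarith
    rw [← gsum_mul]; field_simp
  have hA : HasDerivAt (fun v : ℝ => (1 - v) ^ s) (-(s * (1 - u) ^ (s-1))) u := by
    have := ((hasDerivAt_id u).const_sub 1).rpow_const (p := s) (Or.inl hu1)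
    refine this.congr_deriv ?_
    simp only [id]; ring
  have hd : HasDerivAt (fun v : ℝ => 1 - v^(m+2)) (-((m+2) * u^(m+1))) u := by
    have := (hasDerivAt_pow (m+2) u).const_sub 1
    simpa using this
  have hp : HasDerivAt (fun v : ℝ => v^(m+1)) ((m+1) * u^m) u := by
    simpa using hasDerivAt_pow (m+1) u
  have hl : HasDerivAt (fun v : ℝ => 1 - v) (-1) u := (hasDerivAt_id u).const_sub 1
  have hl2 : HasDerivAt (fun v : ℝ => (s - 1) * v - 1) (s - 1) u := by
    simpa using ((hasDerivAt_id u).const_mul (s-1)).sub_const 1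
  have hR := hA.mul (hp.mul ((((hl.pow 2).const_mul ((m:ℝ)+2)).div (hd.pow 2)
    (pow_ne_zero 2 hq')).add ((hl2.mul hl).div hd hq')))
  have hE : Hf m s =ᶠ[𝓝 u] fun v => (1 - v) ^ s * (v^(m+1) * (((m+2) * (1-v)^2) / (1 - v^(m+2))^2
      + (((s-1) * v - 1) * (1 - v)) / (1 - v^(m+2)))) := by
    filter_upwards [Ioo_mem_nhds h0 h1] with v hv
    have hv1 : 1 - v ≠ 0 := by linarith [hv.2]
    have : 1 - v^(m+2) ≠ 0 := by
      have := pow_lt_one₀ hv.1.le hv.2 (n := m+2) (by omega)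
      linarith
    rw [Hf, hS v hv.2]
    field_simp
    ring
  refine (HasDerivAt.congr_of_eventuallyEq ?_ hE)
  refine hR.congr_deriv ?_
  rw [Gf, hS u h1, Real.rpow_sub_one hu1, add_sub_cancel_right]
  simp only [Pi.pow_apply, Pi.mul_apply, Pi.add_apply, Pi.div_apply]
  have e1 : u ^ (m+1) = u^m * u := by ring
  have e2 : u ^ (m+2) = u^m * u^2 := by ring
  rw [e2] at hq'
  rw [e1, e2]
  generalize u^m = w at *
  generalize (1 - u)^s = A
  generalize hQ : 1 - w * u^2 = Q at *
  field_simp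
  subst hQ
  push_cast
  ring

lemma Gf_deriv (m : ℕ) {s : ℝ} (hs : 0 < s) {u : ℝ} (h0 : 0 < u) (h1 : u < 1) :
    HasDerivAt (fun v => ∫ y in (0:ℝ)..v, Gf m s y) (Gf m s u) u := by
  have hc : ContinuousOn (Gf m s) (Ioo 0 1) := by
    have hg := (gsum_cont (m+2)).continuousOn (s := Ioo 0 1)
    have hne : ∀ x ∈ Ioo (0:ℝ) 1, gsum (m+2) x ≠ 0 :=
      fun x hx => (gsum_pos (by omega) hx.1.le).ne'
    have hr : ∀ t : ℝ, ContinuousOn (fun v : ℝ => (1 - v) ^ t) (Ioo 0 1) := fun t =>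
      ContinuousOn.rpow_const (by fun_prop) fun x hx => Or.inl (by linarith [hx.2])
    have hd : ∀ c : ℕ, ContinuousOn (fun v : ℝ => v ^ c / gsum (m+2) v) (Ioo 0 1) := fun c =>
      ContinuousOn.div (by fun_prop) hg hne
    unfold Gf
    exact ((hr _).sub (((hd _).mul (hr _)).const_smul (s * (1 - s)))).sub
      (((hd _).mul (hr _)).const_smul s)
  apply intervalIntegral.integral_hasDerivAt_right
  · apply (Gf_intble m hs).mono_set
    rw [uIcc_of_le h0.le, uIcc_of_le zero_le_one]
    exact Icc_subset_Icc_right h1.le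
  · exact hc.stronglyMeasurableAtFilter isOpen_Ioo _ ⟨h0, h1⟩
  · exact hc.continuousAt (Ioo_mem_nhds h0 h1)

lemma integrand_eq (m : ℕ) (s : ℝ) {x : ℝ} (hx : 0 < x) :
    x ^ s * (1+x) ^ (-s) * Phi (m+2) x =
     ((1 - (1+x)⁻¹) ^ s * (
      ((1+x)⁻¹ * (1 - (1+x)⁻¹^(m+2)) - (m+2) * (1+x)⁻¹^(m+2) * (1 - (1+x)⁻¹))^2
        + (1+x)⁻¹^(m+2) * ((1 - (1+x)⁻¹^(m+2)) - (m+2) * (1 - (1+x)⁻¹))^2)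
          / ((1 - (1+x)⁻¹^(m+2))^3 * (1+x)⁻¹^2)) * ((1+x)⁻¹)^2 := by
  have hp : 0 < 1 + x := by linarith
  have e0 : 1 - (1+x)⁻¹ = x / (1+x) := by field_simp; ring
  have hy : x ^ s * (1+x) ^ (-s) = (1 - (1+x)⁻¹) ^ s := by
    rw [e0, Real.div_rpow hx.le hp.le, Real.rpow_neg hp.le, div_eq_mul_inv]
  rw [hy, Phi]
  generalize (1 - (1+x)⁻¹) ^ s = A
  rw [mul_div_assoc A, mul_assoc A (_ / _)]
  congr 1
  have hq : 1 < (1+x)^(m+2) := one_lt_pow₀ (by linarith) (by omega)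
  have hq' : (1+x)^(m+2) - 1 ≠ 0 := by linarith
  have hq2 : 1 - ((1+x)^(m+2))⁻¹ ≠ 0 := by
    have := inv_lt_one_of_one_lt₀ hq
    linarith
  rw [show m + 2 - 2 = m by omega, show m + 2 - 1 = m + 1 by omega]
  obtain ⟨y, rfl⟩ : ∃ y, x = y - 1 := ⟨1 + x, by ring⟩
  simp only [add_sub_cancel] at *
  have hw : 0 < y ^ m := by positivity
  have e1 : y ^ (m+1) = y^m * y := by ring
  have e2 : y ^ (m+2) = y^m * y^2 := by ring
  simp only [inv_pow]
  rw [e2] at hq' hq2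
  rw [e1, e2]
  generalize y^m = w at *
  have e3 : 1 - (w * y^2)⁻¹ = (w * y^2 - 1) / (w * y^2) := by field_simp
  rw [e3]
  have e4 : ((m + 2 : ℕ) : ℝ) = m + 2 := by push_cast; ring
  rw [e4]
  generalize hQ : w * y^2 - 1 = Q at *
  field_simp

lemma main_integral (m : ℕ) {s : ℝ} (hs : 0 < s) :
    ∫ x in Ioi (0:ℝ), x ^ s * (1+x) ^ (-s) * Phi (m+2) x = ∫ u in (0:ℝ)..1, Gf m s u := by
  set L : ℝ → ℝ := fun v => (∫ y in (0:ℝ)..v, Gf m s y) + Hf m s v with hL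
  have hLc : ContinuousOn L (Icc 0 1) := by
    apply ContinuousOn.add _ (Hf_cont m hs)
    have := intervalIntegral.continuousOn_primitive_interval' (Gf_intble m hs) left_mem_uIcc
    rwa [uIcc_of_le zero_le_one] at this
  have hL0 : L 0 = 0 := by simp [hL, Hf]
  have hL1 : L 1 = ∫ u in (0:ℝ)..1, Gf m s u := by simp [hL, Hf, Real.zero_rpow hs.ne']
  have hmem : ∀ x : ℝ, 0 ≤ x → (1+x)⁻¹ ∈ Icc (0:ℝ) 1 := fun x hx =>
    ⟨by positivity, inv_le_one_of_one_le₀ (by linarith)⟩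
  have := integral_Ioi_of_hasDerivAt_of_nonneg (a := 0) (l := 0) (g := fun x : ℝ => - L ((1+x)⁻¹))
    (g' := fun x => x ^ s * (1+x) ^ (-s) * Phi (m+2) x) ?_ ?_ ?_ ?_
  · rw [this]; simp [hL1]
  · apply ContinuousWithinAt.neg
    apply ContinuousWithinAt.comp (g := L) (f := fun x : ℝ => (1+x)⁻¹) (t := Icc 0 1)
    · exact hLc _ (hmem 0 le_rfl)
    · apply ContinuousAt.continuousWithinAt
      apply ContinuousAt.inv₀ (by fun_prop) (by norm_num)
    · intro x hx; exact hmem x hx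
  · intro x hx
    have hx : 0 < x := hx
    have h0 : 0 < (1+x)⁻¹ := by positivity
    have h1 : (1+x)⁻¹ < 1 := inv_lt_one_of_one_lt₀ (by linarith)
    have hi : HasDerivAt (fun x : ℝ => (1+x)⁻¹) (-1 / (1+x)^2) x :=
      ((hasDerivAt_id x).const_add 1).inv (by simp only [id]; positivity)
    have hd := (((Gf_deriv m hs h0 h1).add (Hf_deriv m s h0 h1)).comp x hi).neg
    refine hd.congr_deriv ?_
    rw [integrand_eq m s hx]
    rw [inv_pow (1+x) 2]
    ring
  · intro x hx
    have hx : 0 < x := hx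
    have hq : 1 < (1+x)^(m+2) := one_lt_pow₀ (by linarith) (by omega)
    have : 0 ≤ (1+x)^(m+2) - 1 := by linarith
    unfold Phi
    positivity
  · have h1 : Tendsto (fun x : ℝ => (1+x)⁻¹) atTop (𝓝[Icc 0 1] 0) := by
      refine tendsto_nhdsWithin_iff.2 ⟨?_, ?_⟩
      · exact tendsto_inv_atTop_zero.comp (tendsto_atTop_add_const_left _ 1 tendsto_id)
      · filter_upwards [eventually_ge_atTop 0] with x hx using hmem x hx
    have h2 := ((hLc 0 (by simp)).tendsto.comp h1).neg
    rw [hL0, neg_zero] at h2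
    exact h2

/-- For `r < 0`, the series `Σ_{k≥1} Γ(Nk+1)/Γ(Nk+2−r)` and `Σ_{k≥1} Γ(Nk)/Γ(Nk+2−r)`
converge, and the expected Riesz energy integral equals the stated closed form. -/
theorem expected_riesz_energy_series_formula (N : ℕ) (hN : 2 ≤ N) (r : ℝ) (hr : r < 0) :
    (Summable fun k : ℕ =>
      Real.Gamma ((N*(k+1) : ℕ) + 1) / Real.Gamma ((N*(k+1) : ℕ) + 2 - r)) ∧
    (Summable fun k : ℕ =>
      Real.Gamma ((N*(k+1) : ℕ)) / Real.Gamma ((N*(k+1) : ℕ) + 2 - r)) ∧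
    ∫ x in Ioi (0:ℝ), x ^ (-r) * (1+x) ^ r * Phi N x =
      Real.Gamma (1-r) * (1 / Real.Gamma (2-r)
        + r*(1+r) * ∑' k : ℕ,
            Real.Gamma ((N*(k+1) : ℕ) + 1) / Real.Gamma ((N*(k+1) : ℕ) + 2 - r)
        + r*(1-r) * ∑' k : ℕ,
            Real.Gamma ((N*(k+1) : ℕ)) / Real.Gamma ((N*(k+1) : ℕ) + 2 - r)) := by
  obtain ⟨m, rfl⟩ : ∃ m, N = m + 2 := ⟨N - 2, by omega⟩
  obtain ⟨s, rfl⟩ : ∃ s, r = -s := ⟨-r, by ring⟩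
  have hs : 0 < s := by linarith
  have hG1 : Real.Gamma (s + 1) ≠ 0 := (Real.Gamma_pos_of_pos (by linarith)).ne'
  have hG2 : Real.Gamma (s + 2) = (s + 1) * Real.Gamma (s + 1) := by
    rw [show s + 2 = s + 1 + 1 by ring, Real.Gamma_add_one (by linarith)]
  have A := hasSum_term (m+2) (m+2) (by omega) hs
  have B := hasSum_term (m+1) (m+2) (by omega) (t := s + 1) (by linarith)
  have A' : HasSum (fun k : ℕ => Real.Gamma (((m+2)*(k+1) : ℕ) + 1) /
      Real.Gamma (((m+2)*(k+1) : ℕ) + 2 - -s))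
      ((∫ u in (0:ℝ)..1, u ^ (m+2) / gsum (m+2) u * (1 - u) ^ (s - 1)) / Real.Gamma (s+1)) := by
    refine (A.div_const (Real.Gamma (s+1))).congr_fun ?_
    intro k
    rw [show m + 2 + (m+2) * k = (m+2)*(k+1) by ring, beta_nat _ (by linarith),
      show (((m+2)*(k+1) : ℕ) : ℝ) + 2 - -s = ((m+2)*(k+1) : ℕ) + s + 2 by ring]
    field_simp
  have B' : HasSum (fun k : ℕ => Real.Gamma (((m+2)*(k+1) : ℕ)) /
      Real.Gamma (((m+2)*(k+1) : ℕ) + 2 - -s))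
      ((∫ u in (0:ℝ)..1, u ^ (m+1) / gsum (m+2) u * (1 - u) ^ (s + 1 - 1))
        / Real.Gamma (s+2)) := by
    refine (B.div_const (Real.Gamma (s+2))).congr_fun ?_
    intro k
    have e : (((m+2)*(k+1) : ℕ) : ℝ) = ((m + 1 + (m+2) * k : ℕ) : ℝ) + 1 := by push_cast; ring
    rw [beta_nat _ (by linarith), e, show s + 1 + 1 = s + 2 by ring,
      show ((m + 1 + (m+2) * k : ℕ) : ℝ) + 1 + 2 - -s
        = ((m + 1 + (m+2) * k : ℕ) : ℝ) + (s + 1) + 2 by ring]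
    have : Real.Gamma (s + 2) ≠ 0 := (Real.Gamma_pos_of_pos (by linarith)).ne'
    field_simp
  refine ⟨A'.summable, B'.summable, ?_⟩
  have C := beta_nat 0 (t := s) (by linarith)
  simp only [pow_zero, one_mul, Nat.cast_zero, zero_add, Real.Gamma_one] at C
  rw [A'.tsum_eq, B'.tsum_eq, neg_neg, main_integral m hs]
  have D : ∫ u in (0:ℝ)..1, Gf m s u = (∫ u in (0:ℝ)..1, (1 - u) ^ s)
      - s * (1 - s) * (∫ u in (0:ℝ)..1, u ^ (m+2) / gsum (m+2) u * (1 - u) ^ (s - 1))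
      - s * (∫ u in (0:ℝ)..1, u ^ (m+1) / gsum (m+2) u * (1 - u) ^ (s + 1 - 1)) := by
    have i1 := intble_rpow (t := s) (by linarith)
    have i2 := (intble_term (m+2) (m+2) (by omega) (t := s - 1) (by linarith)).const_mul
      (s * (1 - s))
    have i3 := (intble_term (m+1) (m+2) (by omega) (t := s + 1 - 1) (by linarith)).const_mul s
    unfold Gf
    rw [intervalIntegral.integral_sub (i1.sub i2) i3, intervalIntegral.integral_sub i1 i2,
      intervalIntegral.integral_const_mul, intervalIntegral.integral_const_mul]
  rw [D, C, show (1:ℝ) - -s = s + 1 by ring, show (2:ℝ) - -s = s + 2 by ring, hG2]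
  have : s + 1 ≠ 0 := by linarith
  field_simp
  ring
end

section
/- Let N ≥ 1 be an integer and let a > −1 be a real number. Then ∫₀¹ (t^a − 1)/(1 − t^N) dt = −(1/N)·( ψ((a+1)/N) − ψ(1/N) ). -/
open MeasureTheory Set

/-- The digamma function `ψ(x) = Γ'(x)/Γ(x)`. -/
noncomputable def digamma (x : ℝ) : ℝ := deriv Real.Gamma x / Real.Gamma x

lemma digamma_add_one' (x : ℝ) (hx : 0 < x) : digamma (x + 1) = digamma x + 1 / x := by
  have hd : DifferentiableAt ℝ Real.Gamma x :=
    Real.differentiableAt_Gamma (fun m => by have : (0:ℝ) ≤ m := m.cast_nonneg; linarith)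
  have hG := (Real.Gamma_pos_of_pos hx).ne'
  have h1 : deriv Real.Gamma (x + 1) = Real.Gamma x + x * deriv Real.Gamma x := by
    rw [← deriv_comp_add_const]
    have : (fun y => Real.Gamma (y + 1)) =ᶠ[nhds x] fun y => y * Real.Gamma y := by
      filter_upwards [lt_mem_nhds hx] with y hy
      exact Real.Gamma_add_one hy.ne'
    rw [this.deriv_eq]
    have := (hasDerivAt_id x).mul hd.hasDerivAt
    have h2 := this.deriv
    simp only [id, one_mul] at h2
    exact h2
  unfold digamma
  rw [h1, Real.Gamma_add_one hx.ne']
  field_simp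
  ring

lemma digamma_add_nat (x : ℝ) (hx : 0 < x) (n : ℕ) :
    digamma (x + n) = digamma x + ∑ k ∈ Finset.range n, 1 / ((k : ℝ) + x) := by
  induction n with
  | zero => simp
  | succ n ih =>
    rw [Finset.sum_range_succ, ← add_assoc, ← ih, Nat.cast_succ, ← add_assoc,
      digamma_add_one' _ (by positivity), add_comm (n : ℝ) x]

lemma digamma_mono : MonotoneOn digamma (Ioi 0) := by
  have hd : ∀ x ∈ Ioi (0:ℝ), HasDerivAt (Real.log ∘ Real.Gamma) (digamma x) x := by
    intro x hx
    have hx : 0 < x := hx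
    have hd : DifferentiableAt ℝ Real.Gamma x :=
      Real.differentiableAt_Gamma (fun m => by have : (0:ℝ) ≤ m := m.cast_nonneg; linarith)
    exact hd.hasDerivAt.log (Real.Gamma_pos_of_pos hx).ne'
  have := Real.convexOn_log_Gamma.monotoneOn_deriv (fun x hx => (hd x hx).differentiableAt)
  intro x hx y hy hxy
  rw [← (hd x hx).deriv, ← (hd y hy).deriv]
  exact this hx hy hxy

open Filter Topology in
lemma digamma_hasSum_aux (x y : ℝ) (hy : 0 < y) (hxy : y ≤ x) :
    HasSum (fun k : ℕ => 1 / ((k : ℝ) + y) - 1 / ((k : ℝ) + x)) (digamma x - digamma y) := by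
  have hx : 0 < x := by linarith
  rw [hasSum_iff_tendsto_nat_of_nonneg]
  · obtain ⟨m, hm⟩ := exists_nat_ge (x - y)
    have key : ∀ n : ℕ, ∑ k ∈ Finset.range n, (1 / ((k : ℝ) + y) - 1 / ((k : ℝ) + x))
        = (digamma x - digamma y) - (digamma (x + n) - digamma (y + n)) := by
      intro n
      rw [Finset.sum_sub_distrib, digamma_add_nat x hx, digamma_add_nat y hy]; ring
    simp_rw [key]
    have h0 : Tendsto (fun n : ℕ => digamma (x + n) - digamma (y + n)) atTop (𝓝 0) := by
      have hup : Tendsto (fun n : ℕ => (m : ℝ) * (1 / (y + n))) atTop (𝓝 0) := by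
        have : Tendsto (fun n : ℕ => 1 / (y + (n : ℝ))) atTop (𝓝 0) := by
          simp_rw [one_div]
          exact (tendsto_atTop_add_const_left _ y tendsto_natCast_atTop_atTop).inv_tendsto_atTop
        simpa using this.const_mul (m : ℝ)
      refine squeeze_zero (fun n => ?_) (fun n => ?_) hup
      · have : (0:ℝ) ≤ n := n.cast_nonneg
        exact sub_nonneg.2 (digamma_mono (mem_Ioi.2 (by linarith)) (mem_Ioi.2 (by linarith))
          (by linarith))
      · have hn : (0:ℝ) ≤ n := n.cast_nonneg
        have hm0 : (0:ℝ) ≤ m := m.cast_nonneg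
        have h1 : digamma (x + n) ≤ digamma ((y + n) + m) :=
          digamma_mono (mem_Ioi.2 (by linarith)) (mem_Ioi.2 (by linarith)) (by linarith)
        rw [digamma_add_nat (y + n) (by linarith)] at h1
        have h2 : ∑ k ∈ Finset.range m, 1 / ((k : ℝ) + (y + n)) ≤
            ∑ k ∈ Finset.range m, 1 / (y + n) := by
          refine Finset.sum_le_sum fun k _ => ?_
          have : (0:ℝ) ≤ k := k.cast_nonneg
          exact one_div_le_one_div_of_le (by linarith) (by linarith)
        rw [Finset.sum_const, Finset.card_range, nsmul_eq_mul] at h2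
        linarith
    simpa using h0.const_sub (digamma x - digamma y)
  · intro k
    have : (0:ℝ) ≤ k := k.cast_nonneg
    exact sub_nonneg.2 (one_div_le_one_div_of_le (by linarith) (by linarith))

lemma digamma_hasSum (x y : ℝ) (hx : 0 < x) (hy : 0 < y) :
    HasSum (fun k : ℕ => 1 / ((k : ℝ) + y) - 1 / ((k : ℝ) + x)) (digamma x - digamma y) := by
  rcases le_total y x with h | h
  · exact digamma_hasSum_aux x y hy h
  · simpa using (digamma_hasSum_aux y x hx h).neg

lemma rpow_Ioo (r : ℝ) (hr : -1 < r) : IntegrableOn (fun t : ℝ => t ^ r) (Ioo 0 1) ∧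
    ∫ t in Ioo (0:ℝ) 1, t ^ r = 1 / (r + 1) := by
  constructor
  · have := (intervalIntegral.intervalIntegrable_rpow' (a := 0) (b := 1) hr)
    rw [intervalIntegrable_iff_integrableOn_Ioo_of_le zero_le_one] at this
    exact this
  · rw [← integral_Ioc_eq_integral_Ioo, ← intervalIntegral.integral_of_le zero_le_one,
      integral_rpow (Or.inl hr), Real.one_rpow, Real.zero_rpow (by linarith), sub_zero]

/-- `∫₀¹ (t^a − 1)/(1 − t^N) dt = −(1/N)(ψ((a+1)/N) − ψ(1/N))` for `a > −1`, `N ≥ 1`. -/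
theorem integral_digamma_formula (N : ℕ) (hN : 1 ≤ N) (a : ℝ) (ha : -1 < a) :
    ∫ t in Ioo (0:ℝ) 1, (t ^ a - 1) / (1 - t^N) =
      -(1/N) * (digamma ((a+1)/N) - digamma (1/N)) := by
  have hN0 : (0:ℝ) < N := by exact_mod_cast hN
  let F : ℕ → ℝ → ℝ := fun k t => (t ^ a - 1) * (t ^ N) ^ k
  have hFeq : ∀ k, EqOn (F k) (fun t => t ^ (a + N * k) - t ^ ((N : ℝ) * k)) (Ioo 0 1) := by
    intro k t ht
    have h : t ^ ((N : ℝ) * k) = (t ^ N) ^ k := by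
      rw [← pow_mul, ← Real.rpow_natCast]; push_cast; rfl
    simp only [F]
    rw [Real.rpow_add ht.1, h]; ring
  have hp : ∀ k : ℕ, (0:ℝ) ≤ (N : ℝ) * k := fun k => by positivity
  have hFint : ∀ k, IntegrableOn (F k) (Ioo 0 1) := by
    intro k
    have := (rpow_Ioo (a + N * k) (by linarith [hp k])).1.sub
      (rpow_Ioo (N * k) (by linarith [hp k])).1
    exact IntegrableOn.congr_fun this (fun t ht => (hFeq k ht).symm) measurableSet_Ioo
  have hFval : ∀ k, ∫ t in Ioo (0:ℝ) 1, F k t =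
      -(1/N) * (1 / ((k : ℝ) + 1 / N) - 1 / ((k : ℝ) + (a + 1) / N)) := by
    intro k
    rw [setIntegral_congr_fun measurableSet_Ioo (hFeq k), integral_sub
      (rpow_Ioo (a + N * k) (by linarith [hp k])).1 (rpow_Ioo (N * k) (by linarith [hp k])).1,
      (rpow_Ioo (a + N * k) (by linarith [hp k])).2, (rpow_Ioo (N * k) (by linarith [hp k])).2]
    have h1 : (k : ℝ) + 1 / N = (N * k + 1) / N := by field_simp
    have h2 : (k : ℝ) + (a + 1) / N = (a + N * k + 1) / N := by field_simp; ring
    have h3 : (N * k + 1 : ℝ) ≠ 0 := by linarith [hp k]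
    have h4 : (a + N * k + 1 : ℝ) ≠ 0 := by linarith [hp k]
    rw [h1, h2]
    field_simp
    ring
  have hS := (digamma_hasSum ((a+1)/N) (1/N) (div_pos (by linarith) hN0)
    (by positivity)).mul_left (-(1/(N:ℝ)))
  have hnorm : ∀ k, ∫ t in Ioo (0:ℝ) 1, ‖F k t‖ = |∫ t in Ioo (0:ℝ) 1, F k t| := by
    intro k
    rcases le_total 0 a with h | h
    · have hs : ∀ t ∈ Ioo (0:ℝ) 1, F k t ≤ 0 := fun t ht =>
        mul_nonpos_of_nonpos_of_nonneg
          (sub_nonpos.2 (Real.rpow_le_one ht.1.le ht.2.le h))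
          (pow_nonneg (pow_nonneg ht.1.le _) _)
      rw [abs_of_nonpos (setIntegral_nonpos measurableSet_Ioo hs), ← integral_neg]
      exact setIntegral_congr_fun measurableSet_Ioo fun t ht => by
        simp only [Real.norm_eq_abs, abs_of_nonpos (hs t ht)]
    · have hs : ∀ t ∈ Ioo (0:ℝ) 1, 0 ≤ F k t := fun t ht =>
        mul_nonneg
          (sub_nonneg.2 (Real.one_le_rpow_of_pos_of_le_one_of_nonpos ht.1 ht.2.le h))
          (pow_nonneg (pow_nonneg ht.1.le _) _)
      rw [abs_of_nonneg (setIntegral_nonneg measurableSet_Ioo hs)]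
      exact setIntegral_congr_fun measurableSet_Ioo fun t ht => by
        simp only [Real.norm_eq_abs, abs_of_nonneg (hs t ht)]
  have hsum := hasSum_integral_of_summable_integral_norm (μ := volume.restrict (Ioo (0:ℝ) 1))
    hFint (by simp_rw [hnorm, hFval]; exact hS.summable.abs)
  simp_rw [hFval] at hsum
  rw [← hsum.unique hS]
  refine setIntegral_congr_fun measurableSet_Ioo fun t ht => ?_
  have hg := (hasSum_geometric_of_lt_one (pow_nonneg ht.1.le N)
    (pow_lt_one₀ ht.1.le ht.2 (by omega))).mul_left (t ^ a - 1)
  simp only [F]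
  rw [hg.tsum_eq, div_eq_mul_inv]
end

section
/- Let N ≥ 2 and n ≥ 1 be integers. Then 2^{2n} N² · ∫₀^∞ x^{n}(1+x)^{-n} Φ_N(x) dx = 2^{2n} N² ( 1/(n+1) − n(n−1)/(n+1) − n·Σ_{m=1}^{n+1} 1/m ) + 2^{2n} n N ( −γ + Σ_{m=1}^{n+1} C(n+1,m)(−1)^m ψ(m/N)·( (n−1)m/(n+1) + 1 ) ). (This is the exact value of the expected Riesz (−2n)-energy of the N zeros of a random elliptic polynomial mapped to the sphere by stereographic projection.) -/
open MeasureTheory Set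

lemma dg_hasDeriv {x : ℝ} (hx : 0 < x) :
    HasDerivAt (Real.log ∘ Real.Gamma) (digamma x) x := by
  have h : DifferentiableAt ℝ Real.Gamma x := Real.differentiableAt_Gamma (fun m => by
    have : (0:ℝ) ≤ m := Nat.cast_nonneg m
    linarith)
  exact h.hasDerivAt.log (Real.Gamma_pos_of_pos hx).ne'

lemma logGamma_rec {x : ℝ} (hx : 0 < x) :
    (Real.log ∘ Real.Gamma) (x + 1) = (Real.log ∘ Real.Gamma) x + Real.log x := by
  simp only [Function.comp_apply,
      Real.Gamma_add_one hx.ne', Real.log_mul hx.ne' (Real.Gamma_pos_of_pos hx).ne', add_comm]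

lemma dg_rec {x : ℝ} (hx : 0 < x) : digamma (x + 1) = digamma x + 1 / x := by
  have h1 : HasDerivAt (fun y => (Real.log ∘ Real.Gamma) (y + 1)) (digamma (x+1)) x :=
    (dg_hasDeriv (by linarith : 0 < x + 1)).comp_add_const x 1
  have h2 := (dg_hasDeriv hx).add (Real.hasDerivAt_log hx.ne')
  rw [one_div]
  refine h1.unique (h2.congr_of_eventuallyEq ?_)
  filter_upwards [lt_mem_nhds hx] with y hy
  exact logGamma_rec hy

lemma dg_rec_nat {x : ℝ} (hx : 0 < x) (K : ℕ) :
    digamma (x + K) = digamma x + ∑ k ∈ Finset.range K, 1 / (x + k) := by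
  induction K with
  | zero => simp
  | succ K ih =>
    rw [Finset.sum_range_succ, ← add_assoc, ← ih, Nat.cast_succ, ← add_assoc, dg_rec (by positivity)]

lemma dg_le {x : ℝ} (hx : 0 < x) : digamma x ≤ Real.log x := by
  have h := Real.convexOn_log_Gamma.le_slope_of_hasDerivAt (y := x + 1)
    (mem_Ioi.2 hx) (mem_Ioi.2 (by linarith)) (by linarith) (dg_hasDeriv hx)
  rw [slope_def_field, logGamma_rec hx] at h
  simpa using h

lemma le_dg {x : ℝ} (hx : 0 < x) : Real.log x ≤ digamma (x + 1) := by
  have h := Real.convexOn_log_Gamma.slope_le_of_hasDerivAt (y := x + 1)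
    (mem_Ioi.2 hx) (mem_Ioi.2 (by linarith)) (by linarith) (dg_hasDeriv (by linarith))
  rw [slope_def_field, logGamma_rec hx] at h
  simpa using h

open Filter Topology in
lemma dg_asymp {x : ℝ} (hx : 0 < x) :
    Tendsto (fun K : ℕ => digamma (x + K) - Real.log K) atTop (𝓝 0) := by
  have hl : ∀ y : ℝ, Tendsto (fun K : ℕ => Real.log (K + y) - Real.log K) atTop (𝓝 0) := fun y =>
    (Real.tendsto_log_comp_add_sub_log y).comp tendsto_natCast_atTop_atTop
  refine tendsto_of_tendsto_of_tendsto_of_le_of_le' (hl (x-1)) (hl x) ?_ ?_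
  · filter_upwards [eventually_ge_atTop 1] with K hK
    have hK' : (1:ℝ) ≤ K := by exact_mod_cast hK
    have := le_dg (x := K + (x - 1)) (by linarith)
    rw [show (K:ℝ) + (x - 1) + 1 = x + K by ring] at this
    linarith
  · filter_upwards with K
    have := dg_le (x := x + K) (by positivity)
    rw [add_comm (K:ℝ) x]
    linarith

open Filter Topology in
lemma dg_series {x : ℝ} (hx : 0 < x) :
    Tendsto (fun K : ℕ => ∑ k ∈ Finset.range K, (1 / ((k:ℝ) + 1) - 1 / (x + k))) atTop
      (𝓝 (digamma x + Real.eulerMascheroniConstant)) := by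
  have h1 : digamma 1 = -Real.eulerMascheroniConstant := by
    rw [digamma, Real.eulerMascheroniConstant_eq_neg_deriv]; simp
  have h := ((dg_asymp one_pos).sub (dg_asymp hx)).add_const (digamma x - digamma 1)
  rw [h1] at h
  simp only [sub_zero, zero_add, sub_neg_eq_add] at h
  refine h.congr fun K => ?_
  rw [dg_rec_nat hx, dg_rec_nat one_pos, h1, Finset.sum_sub_distrib]
  simp only [add_comm (1:ℝ)]
  ring

/-- geometric sum -/
noncomputable def gs (N : ℕ) (s : ℝ) : ℝ := ∑ i ∈ Finset.range N, s ^ i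

lemma gs_cont (N : ℕ) : Continuous (gs N) := by unfold gs; fun_prop

lemma gs_mul (N : ℕ) (s : ℝ) : (1 - s) * gs N s = 1 - s ^ N := mul_neg_geom_sum s N

lemma gs_pos {N : ℕ} (hN : 1 ≤ N) {s : ℝ} (hs : 0 ≤ s) : 0 < gs N s := by
  obtain ⟨M, rfl⟩ := Nat.exists_eq_add_of_le' hN
  unfold gs
  rw [Finset.sum_range_succ']
  have : 0 ≤ ∑ i ∈ Finset.range M, s ^ (i+1) := Finset.sum_nonneg fun i _ => by positivity
  simp; linarith

/-- bounded quotient `(s^M - s^p)/(1 - s^(M+1))` -/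
noncomputable def hq (M p : ℕ) (s : ℝ) : ℝ := (gs p s - gs M s) / gs (M+1) s

lemma hq_contOn (M p : ℕ) : ContinuousOn (hq M p) (Icc 0 1) := by
  unfold hq
  refine ((gs_cont _).sub (gs_cont _)).continuousOn.div (gs_cont _).continuousOn fun s hs => ?_
  exact (gs_pos (by omega) hs.1).ne'

lemma hq_mul (M p : ℕ) {s : ℝ} (hs : 0 ≤ s) : hq M p s * (1 - s^(M+1)) = s^M - s^p := by
  have := (gs_pos (N := M+1) (by omega) hs).ne'
  rw [← gs_mul, hq]
  field_simp
  have h1 := gs_mul M s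
  have h2 := gs_mul p s
  linear_combination h2 - h1

lemma hq_int (M p : ℕ) : IntervalIntegrable (hq M p) volume 0 1 :=
  (hq_contOn M p).intervalIntegrable_of_Icc zero_le_one

open Filter Topology in
lemma dg_int (M p : ℕ) :
    digamma ((p+1:ℕ) / (M+1:ℕ)) + Real.eulerMascheroniConstant =
      (M+1) * ∫ s in (0:ℝ)..1, hq M p s := by
  have hx : (0:ℝ) < (p+1:ℕ) / (M+1:ℕ) := by positivity
  refine tendsto_nhds_unique (dg_series hx) ?_
  obtain ⟨C, hC⟩ := isCompact_Icc.exists_bound_of_continuousOn (hq_contOn M p)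
  have hC0 : 0 ≤ C := (norm_nonneg _).trans (hC 0 (by simp))
  have key : ∀ K : ℕ, (∑ k ∈ Finset.range K, (1 / ((k:ℝ) + 1) - 1 / (((p+1:ℕ) / (M+1:ℕ) : ℝ) + k)))
      = (M+1) * (∫ s in (0:ℝ)..1, hq M p s) - (M+1) * ∫ s in (0:ℝ)..1, hq M p s * s^((M+1)*K) := by
    intro K
    have hi : IntervalIntegrable (fun s => hq M p s * s^((M+1)*K)) volume 0 1 :=
      ContinuousOn.intervalIntegrable_of_Icc zero_le_one
        ((hq_contOn M p).mul (continuous_pow _).continuousOn)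
    rw [← mul_sub, ← intervalIntegral.integral_sub (hq_int M p) hi]
    have : ∫ s in (0:ℝ)..1, (hq M p s - hq M p s * s^((M+1)*K)) =
        ∫ s in (0:ℝ)..1, ∑ k ∈ Finset.range K, (s^(M+(M+1)*k) - s^(p+(M+1)*k)) := by
      refine intervalIntegral.integral_congr fun s hs => ?_
      rw [uIcc_of_le zero_le_one] at hs
      have e := mul_neg_geom_sum (s^(M+1)) K
      have e2 := hq_mul M p hs.1
      simp only [pow_add, pow_mul, ← sub_mul, ← Finset.mul_sum] at e e2 ⊢
      rw [← e2, mul_assoc, e]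
      ring
    rw [this, intervalIntegral.integral_finsetSum
      (fun k _ => Continuous.intervalIntegrable (by fun_prop) _ _), Finset.mul_sum]
    refine Finset.sum_congr rfl fun k _ => ?_
    rw [intervalIntegral.integral_sub (Continuous.intervalIntegrable (by fun_prop) _ _)
      (Continuous.intervalIntegrable (by fun_prop) _ _), integral_pow, integral_pow]
    push_cast
    have h1 : (M:ℝ) + (M+1)*k + 1 ≠ 0 := by positivity
    have h2 : (p:ℝ) + (M+1)*k + 1 ≠ 0 := by positivity
    have h3 : (p:ℝ) + 1 + k * (M+1) ≠ 0 := by positivity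
    have h4 : (p:ℝ) + 1 + (M+1) * k ≠ 0 := by positivity
    have h5 : (M:ℝ) + 1 ≠ 0 := by positivity
    have h6 : (k:ℝ) + 1 ≠ 0 := by positivity
    have e1 : (M:ℝ) + (M+1)*k + 1 = (M+1)*(k+1) := by ring
    have e2 : ((p:ℝ)+1)/(M+1) + k = (p + (M+1)*k+1)/(M+1) := by field_simp; ring
    rw [e1, e2]
    simp
    field_simp
  simp_rw [key]
  have : Tendsto (fun K : ℕ => ∫ s in (0:ℝ)..1, hq M p s * s^((M+1)*K)) atTop (𝓝 0) := by
    have hb : ∀ K : ℕ, ‖∫ s in (0:ℝ)..1, hq M p s * s^((M+1)*K)‖ ≤ C * (1 / ((K:ℝ) + 1)) := by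
      intro K
      have : ‖∫ s in (0:ℝ)..1, hq M p s * s^((M+1)*K)‖ ≤ ∫ s in (0:ℝ)..1, C * s^K := by
        refine intervalIntegral.norm_integral_le_of_norm_le zero_le_one ?_
          (Continuous.intervalIntegrable (by fun_prop) _ _)
        refine ae_of_all _ fun s hs => ?_
        rw [norm_mul, Real.norm_of_nonneg (pow_nonneg hs.1.le _ : 0 ≤ s^((M+1)*K))]
        refine mul_le_mul (hC s ⟨hs.1.le, hs.2⟩) ?_ (pow_nonneg hs.1.le _) hC0
        exact pow_le_pow_of_le_one hs.1.le hs.2 (by nlinarith)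
      simpa using this
    refine squeeze_zero_norm hb ?_
    simpa using (tendsto_one_div_add_atTop_nhds_zero_nat (𝕜 := ℝ)).const_mul C
  simpa using (this.const_mul ((M:ℝ)+1)).const_sub ((M+1) * ∫ s in (0:ℝ)..1, hq M p s)

/-! ### Integration by parts in the variable `s = 1/(1+x)` -/

noncomputable def Fint (M p : ℕ) (s : ℝ) : ℝ :=
  (1-s)^p * ((gs (M+2) s - (M+2) * s^(M+1))^2 + s^M * (gs (M+2) s - (M+2))^2) / (gs (M+2) s)^3

noncomputable def Bfun (M p : ℕ) (s : ℝ) : ℝ :=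
  -(1-s)^(p+2)/(p+2)
    - (1-s)^(p+1) * ((2*s^(M+2) + (1-s)*s^(M+1)) / gs (M+2) s
      - (M+2) * s^(M+1) / (gs (M+2) s)^2)
    + (p+1) * (1-s)^(p+1) / gs (M+2) s - 2*(p+1)*(1-s)^(p+2)/(p+2)

noncomputable def Rfun (M p : ℕ) (s : ℝ) : ℝ :=
  (1-s)^p * (p - (1-s) * s^(M+1)) / gs (M+2) s

lemma gs_hasDeriv (M : ℕ) {s : ℝ} (hs : s < 1) :
    HasDerivAt (gs (M+2)) ((gs (M+2) s - (M+2) * s^(M+1)) / (1-s)) s := by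
  have hd : DifferentiableAt ℝ (gs (M+2)) s := by unfold gs; fun_prop
  have h1 := ((hasDerivAt_id' s).const_sub 1).mul hd.hasDerivAt
  have h2 : HasDerivAt (fun s : ℝ => 1 - s^(M+2)) (-(((M+2:ℕ):ℝ) * s^(M+1))) s := by
    simpa using (hasDerivAt_pow (M+2) s).const_sub 1
  have h3 := h1.unique (h2.congr_of_eventuallyEq (Filter.Eventually.of_forall (gs_mul (M+2))))
  have hz : 1 - s ≠ 0 := by linarith
  have h4 : deriv (gs (M+2)) s = (gs (M+2) s - (M+2) * s^(M+1)) / (1-s) := by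
    rw [eq_div_iff hz]
    push_cast at h3
    linear_combination h3
  rw [← h4]
  exact hd.hasDerivAt

lemma Bfun_hasDeriv (M p : ℕ) {s : ℝ} (hs0 : 0 < s) (hs : s < 1) :
    HasDerivAt (Bfun M p) (Fint M p s - (p+1) * Rfun M p s) s := by
  have hz : 1 - s ≠ 0 := by linarith
  have hg := (gs_pos (N := M+2) (by omega) hs0.le).ne'
  have dg := gs_hasDeriv M hs
  have dz : ∀ k : ℕ, HasDerivAt (fun s : ℝ => (1-s)^(k+1)) (((k:ℝ)+1)*(1-s)^k*(-1)) s := fun k => by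
    simpa using ((hasDerivAt_id' s).const_sub 1).fun_pow (k+1)
  have ds : ∀ k : ℕ, HasDerivAt (fun s : ℝ => s^(k+1)) (((k:ℝ)+1)*s^k) s := fun k => by
    simpa using hasDerivAt_pow (k+1) s
  have dd := ((((dz (p+1)).neg.div_const ((p:ℝ)+2)).sub ((dz p).mul
    (((((ds (M+1)).const_mul 2).add (((hasDerivAt_id' s).const_sub 1).mul (ds M))).div dg hg).sub
      (((ds M).const_mul ((M:ℝ)+2)).div (dg.pow 2) (pow_ne_zero 2 hg))))).add
      (((dz p).const_mul ((p:ℝ)+1)).div dg hg)).sub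
      (((dz (p+1)).const_mul (2*((p:ℝ)+1))).div_const ((p:ℝ)+2))
  have e := gs_mul (M+2) s
  have hS : s^M = (1 - (1-s) * gs (M+2) s) / s^2 := by
    rw [e]; field_simp; ring
  refine HasDerivAt.congr_deriv (dd.congr_of_eventuallyEq
    (Filter.Eventually.of_forall fun y => ?_)) ?_
  · simp [Bfun]
  · have hp : (p:ℝ) + 2 ≠ 0 := by positivity
    simp only [Fint, Rfun, Pi.pow_apply, Pi.add_apply, Pi.sub_apply, Pi.mul_apply, Pi.div_apply,
      Nat.add_one_sub_one, pow_one, pow_succ s M, pow_succ s (M+1), pow_succ (1-s) p]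
    clear dd dg dz ds
    generalize gs (M+2) s = g at *
    generalize (1-s)^p = Z at *
    rw [hS]
    push_cast
    field_simp
    ring

lemma Fint_contOn (M p : ℕ) : ContinuousOn (Fint M p) (Icc 0 1) := by
  unfold Fint
  have := gs_cont (M+2)
  refine ContinuousOn.div (by fun_prop) (by fun_prop) fun s hs => ?_
  exact pow_ne_zero 3 (gs_pos (by omega) hs.1).ne'

lemma Rfun_contOn (M p : ℕ) : ContinuousOn (Rfun M p) (Icc 0 1) := by
  unfold Rfun
  have := gs_cont (M+2)
  refine ContinuousOn.div (by fun_prop) (by fun_prop) fun s hs => ?_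
  exact (gs_pos (by omega) hs.1).ne'

lemma Bfun_contOn (M p : ℕ) : ContinuousOn (Bfun M p) (Icc 0 1) := by
  unfold Bfun
  have := gs_cont (M+2)
  have h0 : ∀ s ∈ Icc (0:ℝ) 1, gs (M+2) s ≠ 0 := fun s hs => (gs_pos (by omega) hs.1).ne'
  have h1 : ∀ s ∈ Icc (0:ℝ) 1, gs (M+2) s ^ 2 ≠ 0 := fun s hs => pow_ne_zero 2 (h0 s hs)
  fun_prop (disch := assumption)

lemma Fint_integral (M p : ℕ) :
    ∫ s in (0:ℝ)..1, Fint M p s =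
      1/((p:ℝ)+2) - (p+1)*p/(p+2) + (p+1) * ∫ s in (0:ℝ)..1, Rfun M p s := by
  have iF := (Fint_contOn M p).intervalIntegrable_of_Icc (μ := volume) zero_le_one
  have iR := ((Rfun_contOn M p).intervalIntegrable_of_Icc (μ := volume) zero_le_one).const_mul
    ((p:ℝ)+1)
  have h := intervalIntegral.integral_eq_sub_of_hasDerivAt_of_le zero_le_one (Bfun_contOn M p)
    (fun s hs => Bfun_hasDeriv M p hs.1 hs.2) (iF.sub iR)
  rw [intervalIntegral.integral_sub iF iR, intervalIntegral.integral_const_mul] at h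
  have b0 : gs (M+2) 0 = 1 := by simpa using gs_mul (M+2) 0
  have hp : (p:ℝ) + 2 ≠ 0 := by positivity
  have b1 : Bfun M p 1 = 0 := by simp [Bfun]
  have b2 : Bfun M p 0 = -1/(p+2) + (p+1) - 2*(p+1)/(p+2) := by simp [Bfun, b0]
  rw [b1, b2] at h
  rw [sub_eq_iff_eq_add] at h
  rw [h]
  field_simp
  ring

/-! ### Change of variables -/

lemma image_inv : (fun s : ℝ => 1/s - 1) '' Ioo 0 1 = Ioi 0 := by
  ext x
  simp only [mem_image, mem_Ioo, mem_Ioi]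
  constructor
  · rintro ⟨s, ⟨h0, h1⟩, rfl⟩
    have := (one_lt_div h0).2 h1
    linarith
  · intro hx
    refine ⟨1/(1+x), ⟨by positivity, ?_⟩, ?_⟩
    · rw [div_lt_one (by positivity)]; linarith
    · field_simp; ring

lemma integrand_eq_s6 (M p : ℕ) {s : ℝ} (h0 : 0 < s) (h1 : s < 1) :
    |-(1/s^2)| * ((1/s-1)^(p+1) * (1+(1/s-1))^(-((p+1:ℕ):ℤ)) * Phi (M+2) (1/s-1)) = Fint M p s := by
  have hz : 1 - s ≠ 0 := by linarith
  have hg := (gs_pos (N := M+2) (by omega) h0.le).ne'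
  have e := gs_mul (M+2) s
  have hS : s^M = (1 - (1-s) * gs (M+2) s) / s^2 := by
    rw [e]; field_simp; ring
  have hSp : s^M ≠ 0 := by positivity
  rw [abs_neg, abs_of_pos (by positivity), zpow_neg, zpow_natCast, Phi, Fint]
  have a1 : 1 + (1/s - 1) = 1/s := by ring
  have a2 : 1/s - 1 = (1-s)/s := by field_simp
  have a3 : (1/s)^(M+2) - 1 = (1-s) * gs (M+2) s / s^(M+2) := by
    rw [e, div_pow, one_pow]; field_simp
  have a4 : M + 2 - 2 = M := by omega
  have a5 : M + 2 - 1 = M + 1 := by omega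
  rw [a1, a3, a2, a4, a5]
  push_cast
  simp only [div_pow, one_pow, pow_succ s M, pow_succ s (M+1), pow_succ (1-s) p, pow_succ s p]
  generalize gs (M+2) s = g at *
  generalize s^M = S at *
  have hZ : (1-s)^p ≠ 0 := pow_ne_zero _ hz
  generalize (1-s)^p = Z at *
  have hs' : s^p ≠ 0 := by positivity
  generalize s^p = T at *
  field_simp
  try ring

lemma integral_Phi (M p : ℕ) :
    ∫ x in Ioi (0:ℝ), x^(p+1) * (1+x)^(-((p+1:ℕ):ℤ)) * Phi (M+2) x =
      ∫ s in (0:ℝ)..1, Fint M p s := by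
  have hder : ∀ s ∈ Ioo (0:ℝ) 1, HasDerivWithinAt (fun s : ℝ => 1/s - 1) (-(1/s^2)) (Ioo 0 1) s := by
    intro s hs
    have := ((hasDerivAt_inv hs.1.ne').sub_const 1).hasDerivWithinAt (s := Ioo 0 1)
    simpa [one_div] using this
  have hinj : InjOn (fun s : ℝ => 1/s - 1) (Ioo 0 1) := by
    intro a ha b hb h
    simpa using h
  rw [← image_inv, integral_image_eq_integral_abs_deriv_smul measurableSet_Ioo hder hinj,
    intervalIntegral.integral_of_le zero_le_one, integral_Ioc_eq_integral_Ioo]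
  refine setIntegral_congr_fun measurableSet_Ioo fun s hs => ?_
  exact integrand_eq_s6 M p hs.1 hs.2

/-! ### Binomial sums -/

noncomputable def cc (p j : ℕ) : ℝ := ((p+2).choose (j+1) : ℝ) * (-1)^(j+1) * (p*(j+1)/(p+2) + 1)

lemma cc_sum (p : ℕ) (s : ℝ) :
    ∑ j ∈ Finset.range (p+2), cc p j * s^(j+1) = (1-s)^(p+1) * (1 - (p+1) * s) - 1 := by
  have h1 : ∑ j ∈ Finset.range (p+2), ((p+2).choose (j+1) : ℝ) * (-s)^(j+1) = (1-s)^(p+2) - 1 := by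
    have := add_pow (-s) 1 (p+2)
    rw [Finset.sum_range_succ'] at this
    rw [show 1 - s = -s + 1 by ring, this]
    simp [mul_comm]
  have h2 : ∑ j ∈ Finset.range (p+2), ((p+1).choose j : ℝ) * (-s)^j = (1-s)^(p+1) := by
    have := add_pow (-s) 1 (p+1)
    rw [show 1 - s = -s + 1 by ring, this]
    simp [mul_comm]
  have hp : (p:ℝ) + 2 ≠ 0 := by positivity
  have h3 : ∀ j, cc p j * s^(j+1) = ((p+2).choose (j+1) : ℝ) * (-s)^(j+1)
      - p * s * (((p+1).choose j : ℝ) * (-s)^j) := by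
    intro j
    have e : ((p:ℝ)+2) * ((p+1).choose j : ℝ) = ((p+2).choose (j+1) : ℝ) * (j+1) := by
      have := Nat.add_one_mul_choose_eq (p+1) j
      have := congrArg (Nat.cast (R := ℝ)) this
      push_cast at this
      linear_combination this
    have e' : ((p+1).choose j : ℝ) = ((p+2).choose (j+1) : ℝ) * (j+1) / (p+2) := by
      rw [← e]; field_simp
    rw [e', cc, neg_pow s (j+1), neg_pow s j]
    ring
  simp_rw [h3]
  rw [Finset.sum_sub_distrib, ← Finset.mul_sum, h1, h2]
  ring

lemma cc_sum_one (p : ℕ) : ∑ j ∈ Finset.range (p+2), cc p j = -1 := by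
  simpa using cc_sum p 1

lemma pointwise (M p : ℕ) {s : ℝ} (h0 : 0 < s) (h1 : s < 1) :
    ∑ j ∈ Finset.range (p+2), cc p j * hq (M+1) j s - ∑ i ∈ Finset.range (p+2), (1-s)^i
      = Rfun M p s := by
  have hz : 1 - s ≠ 0 := by linarith
  have hg := (gs_pos (N := M+2) (by omega) h0.le).ne'
  have e := gs_mul (M+2) s
  have hq' : 1 - s^(M+2) ≠ 0 := by rw [← e]; positivity
  have e1 : ∀ j, hq (M+1) j s = (s^(M+1) - s^(j+1)/s) / (1 - s^(M+2)) := by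
    intro j
    rw [eq_div_iff hq', hq_mul _ _ h0.le, pow_succ s j]
    field_simp
  have e2 : ∑ j ∈ Finset.range (p+2), cc p j * hq (M+1) j s =
      (-s^(M+1) - ((1-s)^(p+1) * (1 - (p+1) * s) - 1)/s)/ (1 - s^(M+2)) := by
    rw [← cc_sum, Finset.sum_div, ← neg_one_mul, ← cc_sum_one p, Finset.sum_mul,
      ← Finset.sum_sub_distrib, Finset.sum_div]
    refine Finset.sum_congr rfl fun j _ => ?_
    rw [e1]; ring
  have e3 : ∑ i ∈ Finset.range (p+2), (1-s)^i = (1 - (1-s)^(p+2))/s := by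
    rw [eq_div_iff h0.ne', ← mul_neg_geom_sum]; ring
  have hgs : gs (M+2) s = (1 - s^(M+2))/(1-s) := by rw [← e]; field_simp
  rw [e2, e3, Rfun, hgs]
  field_simp
  ring

lemma Rfun_integral (M p : ℕ) :
    ∫ s in (0:ℝ)..1, Rfun M p s =
      ∑ j ∈ Finset.range (p+2), cc p j * (∫ s in (0:ℝ)..1, hq (M+1) j s)
        - ∑ i ∈ Finset.range (p+2), 1/((i:ℝ)+1) := by
  have i1 : ∀ j ∈ Finset.range (p+2),
      IntervalIntegrable (fun s => cc p j * hq (M+1) j s) volume 0 1 :=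
    fun j _ => (hq_int _ _).const_mul _
  have i2 : ∀ i ∈ Finset.range (p+2),
      IntervalIntegrable (fun s : ℝ => (1-s)^i) volume 0 1 :=
    fun j _ => Continuous.intervalIntegrable (by fun_prop) _ _
  have hint : ∀ i : ℕ, ∫ s in (0:ℝ)..1, (1-s)^i = 1/((i:ℝ)+1) := fun i => by
    rw [intervalIntegral.integral_comp_sub_left (fun s : ℝ => s^i) 1]; simp
  simp_rw [← hint, ← intervalIntegral.integral_const_mul]
  rw [← intervalIntegral.integral_finsetSum i1, ← intervalIntegral.integral_finsetSum i2,
    ← intervalIntegral.integral_sub]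
  · rw [intervalIntegral.integral_of_le zero_le_one, intervalIntegral.integral_of_le zero_le_one,
      integral_Ioc_eq_integral_Ioo, integral_Ioc_eq_integral_Ioo]
    exact setIntegral_congr_fun measurableSet_Ioo fun s hs => (pointwise M p hs.1 hs.2).symm
  · have h := IntervalIntegrable.sum _ i1
    rw [Finset.sum_fn] at h
    exact h
  · have h := IntervalIntegrable.sum _ i2
    rw [Finset.sum_fn] at h
    exact h

/-- Exact value of the expected Riesz `(−2n)`-energy of the zeros of a random elliptic
polynomial mapped to the sphere. -/
theorem expected_neg_even_riesz_energy (N n : ℕ) (hN : 2 ≤ N) (hn : 1 ≤ n) :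
    2^(2*n) * N^2 * ∫ x in Ioi (0:ℝ), x^n * (1+x)^(-(n:ℤ)) * Phi N x =
      2^(2*n) * (N:ℝ)^2 * (1/(n+1) - n*(n-1)/(n+1) - n * ∑ m ∈ Finset.Icc 1 (n+1), (1:ℝ)/m)
      + 2^(2*n) * n * N * (-Real.eulerMascheroniConstant
          + ∑ m ∈ Finset.Icc 1 (n+1),
              ((n+1).choose m : ℝ) * (-1)^m * digamma (m/N) * ((n-1)*m/(n+1) + 1)) := by
  obtain ⟨M, rfl⟩ := Nat.exists_eq_add_of_le' hN
  obtain ⟨p, rfl⟩ := Nat.exists_eq_add_of_le' hn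
  have hI : ∀ f : ℕ → ℝ, ∑ m ∈ Finset.Icc 1 (p+1+1), f m =
      ∑ j ∈ Finset.range (p+2), f (j+1) := by
    intro f
    rw [Finset.range_eq_Ico, Finset.sum_Ico_add' f 0 (p+2) 1]
    rfl
  rw [integral_Phi, Fint_integral, Rfun_integral, hI, hI]
  have hN0 : ((M:ℝ)+2) ≠ 0 := by positivity
  have hp : ((p:ℝ)+2) ≠ 0 := by positivity
  have hd : ∀ j, ∫ s in (0:ℝ)..1, hq (M+1) j s =
      (digamma ((j+1:ℕ)/(M+2:ℕ)) + Real.eulerMascheroniConstant) / (M+2) := by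
    intro j
    rw [dg_int (M+1) j]
    push_cast
    field_simp
    ring
  have hS : ∑ j ∈ Finset.range (p+2), cc p j * (∫ s in (0:ℝ)..1, hq (M+1) j s) =
      (-Real.eulerMascheroniConstant + ∑ j ∈ Finset.range (p+2),
        cc p j * digamma ((j+1:ℕ)/(M+2:ℕ))) / (M+2) := by
    rw [← neg_one_mul, ← cc_sum_one p, Finset.sum_mul, ← Finset.sum_add_distrib, Finset.sum_div]
    refine Finset.sum_congr rfl fun j _ => ?_
    rw [hd]; ring
  have hT : ∑ j ∈ Finset.range (p+2), ((p+1+1).choose (j+1) : ℝ) * (-1)^(j+1)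
      * digamma ((j+1:ℕ)/(M+2:ℕ)) * ((((p+1:ℕ):ℝ)-1)*((j+1:ℕ):ℝ)/(((p+1:ℕ):ℝ)+1) + 1) =
      ∑ j ∈ Finset.range (p+2), cc p j * digamma ((j+1:ℕ)/(M+2:ℕ)) := by
    refine Finset.sum_congr rfl fun j _ => ?_
    rw [cc]
    push_cast
    rw [show (p:ℝ)+1+1 = p+2 by ring]
    ring
  rw [hS, hT]
  generalize ∑ j ∈ Finset.range (p+2), cc p j * digamma ((j+1:ℕ)/(M+2:ℕ)) = T
  push_cast
  generalize ∑ j ∈ Finset.range (p+2), 1/((j:ℝ)+1) = H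
  rw [show (p:ℝ)+1+1 = p+2 by ring]
  field_simp
  ring
end

section
/- Let N ≥ 1 be an integer. Then lim_{r→0⁻} r·∫₀¹ (1−t)^{-r} · t^N/(1−t^N) dt = −1/N, i.e. the function r ↦ r·∫₀¹ (1−t)^{-r} t^N/(1−t^N) dt, defined for r < 0, tends to −1/N as r tends to 0 from the left. -/
open MeasureTheory Set Filter

lemma aux_bound (N : ℕ) (hN : 1 ≤ N) (r t : ℝ) (hr : r < 0) (ht : t ∈ Ioo (0:ℝ) 1) :
    ‖(1-t) ^ (-r) * (t^N / (1 - t^N)) - (1-t)^(-r-1) * (1/N)‖ ≤ N := by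
  obtain ⟨h0, h1⟩ := ht
  have hu : 0 < 1 - t := by linarith
  have hNpos : (0:ℝ) < N := by exact_mod_cast hN
  have hgeom : (∑ k ∈ Finset.range N, t^k) * (1 - t) = 1 - t^N := geom_sum_mul_neg t N
  have hS1 : 1 ≤ ∑ k ∈ Finset.range N, t^k := by
    have := Finset.single_le_sum (f := fun k => t^k) (s := Finset.range N)
      (fun i _ => by positivity) (Finset.mem_range.2 hN)
    simpa using this
  have hSN : ∑ k ∈ Finset.range N, t^k ≤ N := by
    have := Finset.sum_le_card_nsmul (Finset.range N) (fun k => t^k) 1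
      (fun k _ => pow_le_one₀ h0.le h1.le)
    simpa using this
  have hSlow : N * t^N ≤ ∑ k ∈ Finset.range N, t^k := by
    have := Finset.card_nsmul_le_sum (Finset.range N) (fun k => t^k) (t^N)
      (fun k hk => pow_le_pow_of_le_one h0.le h1.le (Finset.mem_range.1 hk).le)
    simpa using this
  set S := ∑ k ∈ Finset.range N, t^k with hS
  have hSpos : 0 < S := by linarith
  have hp : (1-t)^(-r) = (1-t)^(-r-1) * (1-t) := by
    rw [Real.rpow_sub_one hu.ne']; field_simp
  have hle1 : (1-t)^(-r) ≤ 1 := Real.rpow_le_one hu.le (by linarith) (by linarith)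
  have hnn : 0 ≤ (1-t)^(-r) := Real.rpow_nonneg hu.le _
  have hpn : 0 ≤ (1-t)^(-r-1) := Real.rpow_nonneg hu.le _
  have key : (1-t) ^ (-r) * (t^N / (1 - t^N)) - (1-t)^(-r-1) * (1/N)
      = -((1-t)^(-r-1) * ((S - N * t^N) / (N * S))) := by
    rw [hp, ← hgeom]; field_simp; ring
  have hb : (S - N * t^N) / (N * S) ≤ N * (1-t) := by
    rw [div_le_iff₀ (by positivity)]
    have : S - N * t^N ≤ N * (S * (1-t)) := by rw [hgeom]; linarith
    have h2 : 0 ≤ N * (S * (1-t)) := by positivity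
    have h3 : (1:ℝ) ≤ N := by exact_mod_cast hN
    nlinarith
  have hb0 : 0 ≤ (S - N * t^N) / (N * S) := div_nonneg (by linarith) (by positivity)
  rw [key, norm_neg, Real.norm_eq_abs, abs_of_nonneg (mul_nonneg hpn hb0)]
  calc _ ≤ (1-t)^(-r-1) * (N * (1-t)) := mul_le_mul_of_nonneg_left hb hpn
    _ = N * (1-t)^(-r) := by rw [hp]; ring
    _ ≤ N := by nlinarith

lemma aux_int (r : ℝ) (hr : r < 0) :
    IntegrableOn (fun t : ℝ => (1-t)^(-r-1)) (Ioo 0 1) ∧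
    ∫ t in Ioo (0:ℝ) 1, (1-t)^(-r-1) = 1 / (-r) := by
  have h := (intervalIntegral.intervalIntegrable_rpow' (a := 0) (b := 1) (r := -r-1)
    (by linarith)).comp_sub_left 1
  constructor
  · simp only [sub_zero, sub_self] at h
    exact ((intervalIntegrable_iff_integrableOn_Ioo_of_le zero_le_one).1 h.symm)
  · rw [← integral_Ioc_eq_integral_Ioo, ← intervalIntegral.integral_of_le zero_le_one,
      intervalIntegral.integral_comp_sub_left (fun x : ℝ => x^(-r-1)) 1,
      integral_rpow (Or.inl (by linarith))]
    have : -r ≠ 0 := by linarith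
    simp [this, Real.zero_rpow (neg_ne_zero.1 this |> neg_ne_zero.2)]

lemma aux_main (N : ℕ) (hN : 1 ≤ N) (r : ℝ) (hr : r < 0) :
    |(r * ∫ t in Ioo (0:ℝ) 1, (1-t) ^ (-r) * (t^N / (1 - t^N))) - (-1/N)| ≤ N * |r| := by
  obtain ⟨hi, he⟩ := aux_int r hr
  have hi' := hi.mul_const (1/(N:ℝ))
  have hbd : ∀ t ∈ Ioo (0:ℝ) 1, _ := fun t ht => aux_bound N hN r t hr ht
  have hd : IntegrableOn (fun t : ℝ => (1-t) ^ (-r) * (t^N / (1 - t^N)) - (1-t)^(-r-1) * (1/N))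
      (Ioo 0 1) := by
    refine IntegrableOn.of_bound (by simp) (Measurable.aestronglyMeasurable (by fun_prop)) N ?_
    exact (ae_restrict_iff' measurableSet_Ioo).2 (ae_of_all _ hbd)
  have hn := norm_setIntegral_le_of_norm_le_const (μ := volume) (by simp) hbd
  have hsum : ∫ t in Ioo (0:ℝ) 1, (1-t) ^ (-r) * (t^N / (1 - t^N)) =
      (∫ t in Ioo (0:ℝ) 1, ((1-t) ^ (-r) * (t^N / (1 - t^N)) - (1-t)^(-r-1) * (1/N)))
        + 1/(-r) * (1/N) := by
    rw [← he, ← integral_mul_const, ← integral_add hd hi']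
    simp
  have hNpos : (0:ℝ) < N := by exact_mod_cast hN
  rw [hsum]
  set D := ∫ t in Ioo (0:ℝ) 1, ((1-t) ^ (-r) * (t^N / (1 - t^N)) - (1-t)^(-r-1) * (1/N))
  have : r * (D + 1/(-r) * (1/N)) - (-1/N) = D * r := by
    have := hr.ne
    field_simp; ring
  rw [this, abs_mul]
  have hn' : |D| ≤ N := by simpa using hn
  exact mul_le_mul_of_nonneg_right hn' (abs_nonneg r)

/-- As `r → 0⁻`, `r·∫₀¹ (1−t)^{-r} t^N/(1−t^N) dt → −1/N`. -/
theorem limit_r_times_integral (N : ℕ) (hN : 1 ≤ N) :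
    Tendsto (fun r : ℝ => r * ∫ t in Ioo (0:ℝ) 1, (1-t) ^ (-r) * (t^N / (1 - t^N)))
      (nhdsWithin 0 (Iio 0)) (nhds (-1/N)) := by
  rw [tendsto_iff_norm_sub_tendsto_zero]
  have h : Tendsto (fun r : ℝ => (N:ℝ) * |r|) (nhdsWithin 0 (Iio 0)) (nhds 0) := by
    have : Continuous (fun r : ℝ => (N:ℝ) * |r|) := by fun_prop
    have := this.tendsto 0
    simp only [abs_zero, mul_zero] at this
    exact this.mono_left nhdsWithin_le_nhds
  refine squeeze_zero' (Eventually.of_forall fun _ => norm_nonneg _) ?_ h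
  filter_upwards [self_mem_nhdsWithin] with r hr
  exact aux_main N hN r hr
end

section
/- As N → ∞ through the positive integers, −π·Σ_{j=1}^{N−1} (j/N)·cot(πj/N) − N log N − (γ − log(2π))·N converges to 1. -/
open Filter Real

/-- log Gamma -/
noncomputable def LG (x : ℝ) : ℝ := Real.log (Real.Gamma x)

noncomputable def phi (x : ℝ) : ℝ := -2 + x * (deriv LG (1 + x) - deriv LG (2 - x))

lemma analyticAt_Gamma_real {x : ℝ} (hx : 0 < x) : AnalyticAt ℝ Real.Gamma x := by
  have h1 : AnalyticAt ℂ Complex.Gamma (x : ℂ) := by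
    rw [Complex.analyticAt_iff_eventually_differentiableAt]
    have : ∀ᶠ z : ℂ in nhds (x : ℂ), 0 < z.re :=
      Complex.continuous_re.continuousAt.eventually (lt_mem_nhds (by simpa using hx))
    filter_upwards [this] with z hz
    apply Complex.differentiableAt_Gamma
    intro m hm
    rw [hm] at hz
    simp at hz
    have := Nat.cast_nonneg (α := ℝ) m
    linarith
  have h2 : AnalyticAt ℝ Complex.Gamma (x : ℂ) := h1.restrictScalars
  have h3 : AnalyticAt ℝ (fun y : ℝ => (Complex.Gamma (y : ℂ)).re) x :=
    (Complex.reCLM.analyticAt _).comp (h2.comp (Complex.ofRealCLM.analyticAt x))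
  exact h3

lemma analyticAt_LG {x : ℝ} (hx : 0 < x) : AnalyticAt ℝ LG x :=
  AnalyticAt.log (analyticAt_Gamma_real hx) (Real.Gamma_pos_of_pos hx)

lemma analyticAt_phi {x : ℝ} (h0 : 0 ≤ x) (h1 : x ≤ 1) : AnalyticAt ℝ phi x := by
  unfold phi
  have hA : AnalyticAt ℝ (deriv LG) (1 + x) := (analyticAt_LG (by linarith)).deriv
  have hB : AnalyticAt ℝ (deriv LG) (2 - x) := (analyticAt_LG (by linarith)).deriv
  have hA' : AnalyticAt ℝ (fun y : ℝ => deriv LG (1 + y)) x :=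
    AnalyticAt.fun_comp (f := fun y : ℝ => 1 + y) hA (by fun_prop)
  have hB' : AnalyticAt ℝ (fun y : ℝ => deriv LG (2 - y)) x :=
    AnalyticAt.fun_comp (f := fun y : ℝ => 2 - y) hB (by fun_prop)
  exact analyticAt_const.add (analyticAt_id.mul (hA'.sub hB'))

lemma LG_rec {x : ℝ} (hx : 0 < x) : LG (x + 1) = Real.log x + LG x := by
  unfold LG
  rw [Real.Gamma_add_one hx.ne', Real.log_mul hx.ne' (Real.Gamma_pos_of_pos hx).ne']

lemma dLG_two : deriv LG 2 = deriv LG 1 + 1 := by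
  have h1 : HasDerivAt LG (deriv LG 1) 1 := (analyticAt_LG one_pos).differentiableAt.hasDerivAt
  have h2 : HasDerivAt LG (deriv LG 2) (1 + 1) := by
    have := (analyticAt_LG two_pos).differentiableAt.hasDerivAt
    norm_num at this ⊢
    exact this
  have h3 := h2.comp_add_const 1 1
  have h4 := (Real.hasDerivAt_log one_ne_zero).add h1
  have h5 : (fun x => LG (x + 1)) =ᶠ[nhds 1] (Real.log + LG) := by
    filter_upwards [lt_mem_nhds one_pos] with x hx using LG_rec hx
  have := h3.unique (h4.congr_of_eventuallyEq h5)
  rw [this]; norm_num; ring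

lemma phi_zero : phi 0 = -2 := by simp [phi]
lemma phi_one : phi 1 = -1 := by
  have : phi 1 = -2 + 1 * (deriv LG 2 - deriv LG 1) := by unfold phi; norm_num
  rw [this, dLG_two]; ring

lemma LG_refl {x : ℝ} (h0 : 0 < x) (h1 : x < 1) :
    LG (1 + x) + LG (2 - x)
      = Real.log π + Real.log x + Real.log (1 - x) - Real.log (Real.sin (π * x)) := by
  have hs : 0 < Real.sin (π * x) := Real.sin_pos_of_pos_of_lt_pi (by positivity)
    (by nlinarith [Real.pi_pos])
  have e1 : LG (1 + x) = Real.log x + LG x := by rw [add_comm]; exact LG_rec h0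
  have e2 : LG (2 - x) = Real.log (1 - x) + LG (1 - x) := by
    rw [← LG_rec (by linarith)]; congr 1; ring
  have e3 : LG x + LG (1 - x) = Real.log π - Real.log (Real.sin (π * x)) := by
    unfold LG
    rw [← Real.log_mul (Real.Gamma_pos_of_pos h0).ne' (Real.Gamma_pos_of_pos (by linarith)).ne',
      Real.Gamma_mul_Gamma_one_sub, Real.log_div Real.pi_ne_zero hs.ne']
  linarith

lemma hasDerivAt_G {x : ℝ} (h0 : 0 ≤ x) (h1 : x ≤ 1) :
    HasDerivAt (fun y => LG (1 + y) + LG (2 - y)) (deriv LG (1 + x) - deriv LG (2 - x)) x := by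
  have hA : HasDerivAt LG (deriv LG (1 + x)) (1 + x) :=
    (analyticAt_LG (by linarith)).differentiableAt.hasDerivAt
  have hB : HasDerivAt LG (deriv LG (2 - x)) (2 - x) :=
    (analyticAt_LG (by linarith)).differentiableAt.hasDerivAt
  exact (hA.comp_const_add 1 x).add (hB.comp_const_sub 2 x)

lemma phi_eq {x : ℝ} (h0 : 0 < x) (h1 : x < 1) :
    -π * (x * Real.cot (π * x)) = phi x + 1 / (1 - x) := by
  have hs : 0 < Real.sin (π * x) := Real.sin_pos_of_pos_of_lt_pi (by positivity)
    (by nlinarith [Real.pi_pos])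
  have hd := hasDerivAt_G h0.le h1.le
  have hsin : HasDerivAt (fun y => Real.sin (π * y)) (Real.cos (π * x) * (π * 1)) x :=
    ((hasDerivAt_id x).const_mul π).sin
  have hd2 : HasDerivAt (fun y => Real.log π + Real.log y + Real.log (1 - y)
      - Real.log (Real.sin (π * y))) (0 + x⁻¹ + (-(1 - x)⁻¹)
      - Real.cos (π * x) * (π * 1) / Real.sin (π * x)) x := 
    (((hasDerivAt_const x (Real.log π)).add (Real.hasDerivAt_log h0.ne')).add
      ((Real.hasDerivAt_log (by linarith)).comp_const_sub 1 x)).sub (hsin.log hs.ne')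
  have he : (fun y => LG (1 + y) + LG (2 - y)) =ᶠ[nhds x] (fun y => Real.log π + Real.log y
      + Real.log (1 - y) - Real.log (Real.sin (π * y))) := by
    filter_upwards [lt_mem_nhds h0, gt_mem_nhds h1] with y ha hb using LG_refl ha hb
  have := hd.unique (hd2.congr_of_eventuallyEq he)
  unfold phi
  rw [this, Real.cot_eq_cos_div_sin]
  have h2 : 1 - x ≠ 0 := by linarith
  field_simp
  ring

lemma integral_G : ∫ x in (0:ℝ)..1, (LG (1 + x) + LG (2 - x)) = Real.log (2 * π) - 2 := by
  have e : ∫ x in (0:ℝ)..1, (LG (1 + x) + LG (2 - x)) = ∫ x in (0:ℝ)..1,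
      (Real.log π + Real.log x + Real.log (1 - x) - Real.log (Real.sin (π * x))) := by
    apply intervalIntegral.integral_congr_ae
    have : ∀ᵐ x : ℝ, x ≠ 1 := by simp [MeasureTheory.ae_iff]
    filter_upwards [this] with x hx hm
    rw [Set.uIoc_of_le zero_le_one] at hm
    exact LG_refl hm.1 (lt_of_le_of_ne hm.2 hx)
  have i1 : IntervalIntegrable (fun x : ℝ => Real.log x) MeasureTheory.volume 0 1 :=
    intervalIntegral.intervalIntegrable_log'
  have i2 : IntervalIntegrable (fun x : ℝ => Real.log (1 - x)) MeasureTheory.volume 0 1 := by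
    have := (intervalIntegral.intervalIntegrable_log' (a := 1) (b := 0)).comp_sub_left 1
    simpa using this
  have i3 : IntervalIntegrable (fun x : ℝ => Real.log (Real.sin (π * x)))
      MeasureTheory.volume 0 1 := by
    have := (intervalIntegrable_log_sin (a := 0) (b := π)).comp_mul_left (c := π)
    simpa [Function.comp_def, Real.pi_ne_zero] using this
  have i0 : IntervalIntegrable (fun x : ℝ => Real.log π) MeasureTheory.volume 0 1 :=
    intervalIntegrable_const
  have v1 : ∫ x in (0:ℝ)..1, Real.log x = -1 := by rw [integral_log]; simp
  have v2 : ∫ x in (0:ℝ)..1, Real.log (1 - x) = -1 := by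
    rw [intervalIntegral.integral_comp_sub_left (fun x => Real.log x) 1]; simpa using v1
  have v3 : ∫ x in (0:ℝ)..1, Real.log (Real.sin (π * x)) = -Real.log 2 := by
    rw [intervalIntegral.integral_comp_mul_left (fun x => Real.log (Real.sin x)) Real.pi_ne_zero]
    simp only [mul_zero, mul_one, integral_log_sin_zero_pi, smul_eq_mul]
    field_simp
  rw [e, intervalIntegral.integral_sub ((i0.add i1).add i2) i3,
    intervalIntegral.integral_add (i0.add i1) i2, intervalIntegral.integral_add i0 i1, v1, v2, v3,
    Real.log_mul two_ne_zero Real.pi_ne_zero]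
  simp
  ring

lemma integral_phi : ∫ x in (0:ℝ)..1, phi x = -Real.log (2 * π) := by
  have hphi : IntervalIntegrable phi MeasureTheory.volume 0 1 := by
    apply ContinuousOn.intervalIntegrable
    intro x hx
    rw [Set.uIcc_of_le zero_le_one] at hx
    exact (analyticAt_phi hx.1 hx.2).continuousAt.continuousWithinAt
  have hG : IntervalIntegrable (fun x => LG (1 + x) + LG (2 - x)) MeasureTheory.volume 0 1 := by
    apply ContinuousOn.intervalIntegrable
    intro x hx
    rw [Set.uIcc_of_le zero_le_one] at hx
    exact (hasDerivAt_G hx.1 hx.2).continuousAt.continuousWithinAt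
  have key : ∫ x in (0:ℝ)..1, (phi x + (LG (1 + x) + LG (2 - x))) = -2 := by
    have := intervalIntegral.integral_eq_sub_of_hasDerivAt (a := 0) (b := 1)
      (f := fun x => -2 * x + x * (LG (1 + x) + LG (2 - x)))
      (f' := fun x => phi x + (LG (1 + x) + LG (2 - x))) ?_ (hphi.add hG)
    · rw [this]
      have h1 : LG 1 = 0 := by simp [LG]
      have h2 : LG 2 = 0 := by simp [LG]
      norm_num [h1, h2]
    · intro x hx
      rw [Set.uIcc_of_le zero_le_one] at hx
      convert ((hasDerivAt_id x).const_mul (-2)).add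
        ((hasDerivAt_id x).mul (hasDerivAt_G hx.1 hx.2)) using 1
      · rfl
      · simp [phi]; ring
  rw [intervalIntegral.integral_add hphi hG, integral_G] at key
  linarith

lemma trap_tendsto : Tendsto (fun N : ℕ => (N : ℝ) * trapezoidal_error phi N 0 1) atTop (nhds 0) := by
  have hc : ContDiffOn ℝ 2 phi (Set.uIcc 0 1) := by
    intro x hx
    rw [Set.uIcc_of_le zero_le_one] at hx
    exact (analyticAt_phi hx.1 hx.2).contDiffAt.contDiffWithinAt
  have hu : UniqueDiffOn ℝ (Set.uIcc (0:ℝ) 1) := by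
    rw [Set.uIcc_of_le zero_le_one]; exact uniqueDiffOn_Icc one_pos
  have hcont := hc.continuousOn_iteratedDerivWithin (m := 2) le_rfl hu
  obtain ⟨C, hC⟩ := isCompact_uIcc.exists_bound_of_continuousOn hcont
  have hb : ∀ x, |iteratedDerivWithin 2 phi (Set.uIcc 0 1) x| ≤ max C 0 := by
    intro x
    by_cases hx : x ∈ Set.uIcc (0:ℝ) 1
    · exact (hC x hx).trans (le_max_left _ _)
    · rw [iteratedDerivWithin_succ, derivWithin_zero_of_notMem_closure]
      · simp
      · rwa [isCompact_uIcc.isClosed.closure_eq]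
  have hlim : Tendsto (fun N : ℕ => (max C 0 / 12) * (1 / (N : ℝ))) atTop (nhds 0) := by
    simpa using (tendsto_one_div_atTop_nhds_zero_nat (𝕜 := ℝ)).const_mul (max C 0 / 12)
  apply squeeze_zero_norm' _ hlim
  filter_upwards [eventually_gt_atTop 0] with N hN
  have := trapezoidal_error_le_of_c2 hc hb hN
  have hN' : (0:ℝ) < N := by exact_mod_cast hN
  rw [norm_mul, Real.norm_eq_abs, Real.norm_eq_abs, abs_of_pos hN']
  calc (N:ℝ) * |trapezoidal_error phi N 0 1| ≤ N * (|1 - 0| ^ 3 * max C 0 / (12 * N ^ 2)) := by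
        gcongr
    _ = _ := by simp; field_simp

noncomputable def aseq (n : ℕ) : ℝ := (harmonic n : ℝ) - Real.log n - Real.eulerMascheroniConstant

lemma aseq_tendsto : Tendsto aseq atTop (nhds 0) := by
  unfold aseq
  simpa using Real.tendsto_harmonic_sub_log.sub_const Real.eulerMascheroniConstant

lemma aseq_diff (n : ℕ) (hn : 0 < n) : aseq (n + 1) - aseq n
    = 1 / ((n:ℝ) + 1) - Real.log (1 + 1 / n) := by
  have hn' : (0:ℝ) < n := by exact_mod_cast hn
  have : 1 + 1 / (n:ℝ) = (n + 1) / n := by field_simp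
  rw [this, Real.log_div (by positivity) (by positivity)]
  simp [aseq, harmonic_succ]
  ring

lemma log_le_half {y : ℝ} (hy : 1 ≤ y) : Real.log y ≤ (y - y⁻¹) / 2 := by
  have := Real.self_le_sinh_iff.2 (Real.log_nonneg hy)
  rwa [Real.sinh_log (by linarith)] at this

lemma aseq_le (n : ℕ) (hn : 0 < n) : aseq n ≤ 1 / (2 * n) := by
  have hm : Monotone (fun k : ℕ => aseq (k + 1) - 1 / (2 * ((k:ℝ) + 1))) := by
    apply monotone_nat_of_le_succ
    intro k
    have h := aseq_diff (k + 1) (by omega)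
    have h2 := log_le_half (y := 1 + 1 / ((k + 1 : ℕ) : ℝ)) (by simp; positivity)
    push_cast at h h2 ⊢
    have : ((1 + 1 / ((k:ℝ) + 1)) - (1 + 1 / ((k:ℝ) + 1))⁻¹) / 2
      = 1 / ((k:ℝ) + 1 + 1) - 1 / (2 * (k + 1 + 1)) + 1 / (2 * (k + 1)) := by
      have : 1 + 1 / ((k:ℝ) + 1) = (k + 2) / (k + 1) := by field_simp; ring
      rw [this, inv_div]
      have : (k:ℝ) + 1 + 1 = k + 2 := by ring
      rw [this]
      field_simp
      ring
    linarith
  have hl : Tendsto (fun k : ℕ => aseq (k + 1) - 1 / (2 * ((k:ℝ) + 1))) atTop (nhds 0) := by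
    have h1 := (tendsto_add_atTop_iff_nat 1).2 aseq_tendsto
    have h2 := (tendsto_one_div_add_atTop_nhds_zero_nat (𝕜 := ℝ)).const_mul (1 / 2)
    have := h1.sub h2
    simp only [mul_zero, sub_zero] at this
    refine this.congr fun k => ?_
    field_simp
  have := hm.ge_of_tendsto hl (n - 1)
  obtain ⟨k, rfl⟩ : ∃ k, n = k + 1 := ⟨n - 1, by omega⟩
  simp only [Nat.add_sub_cancel] at this
  push_cast
  linarith

lemma le_aseq (n : ℕ) (hn : 0 < n) : 1 / (2 * ((n:ℝ) + 1)) ≤ aseq n := by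
  have hm : Antitone (fun k : ℕ => aseq (k + 1) - 1 / (2 * ((k:ℝ) + 2))) := by
    apply antitone_nat_of_succ_le
    intro k
    have h := aseq_diff (k + 1) (by omega)
    have h2 := Real.le_log_one_add_of_nonneg (x := 1 / ((k + 1 : ℕ) : ℝ)) (by positivity)
    push_cast at h h2 ⊢
    have : 1 / ((k:ℝ) + 1 + 1) + 1 / (2 * (k + 2)) - 1 / (2 * (k + 1 + 2)) 
       ≤ 2 * (1 / ((k:ℝ) + 1)) / (1 / ((k:ℝ) + 1) + 2) := by
      have e1 : 2 * (1 / ((k:ℝ) + 1)) / (1 / ((k:ℝ) + 1) + 2) = 2 / (2 * k + 3) := by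
        field_simp; ring
      have e2 : 1 / ((k:ℝ) + 1 + 1) + 1 / (2 * (k + 2)) - 1 / (2 * (k + 1 + 2)) =
          (2 * k + 7) / (2 * (k + 2) * (k + 3)) := by
        have : (k:ℝ) + 1 + 1 = k + 2 := by ring
        have h3 : (k:ℝ) + 1 + 2 = k + 3 := by ring
        rw [this, h3]
        field_simp
        ring
      rw [e1, e2, div_le_div_iff₀ (by positivity) (by positivity)]
      nlinarith
    linarith
  have hl : Tendsto (fun k : ℕ => aseq (k + 1) - 1 / (2 * ((k:ℝ) + 2))) atTop (nhds 0) := by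
    have h1 := (tendsto_add_atTop_iff_nat 1).2 aseq_tendsto
    have h2 := ((tendsto_add_atTop_iff_nat 1).2
      (tendsto_one_div_add_atTop_nhds_zero_nat (𝕜 := ℝ))).const_mul (1 / 2)
    have := h1.sub h2
    simp only [mul_zero, sub_zero] at this
    refine this.congr fun k => ?_
    push_cast
    have h3 : (k:ℝ) + 1 + 1 = k + 2 := by ring
    rw [h3]
    field_simp
  have := hm.le_of_tendsto hl (n - 1)
  obtain ⟨k, rfl⟩ : ∃ k, n = k + 1 := ⟨n - 1, by omega⟩
  simp only [Nat.add_sub_cancel] at this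
  push_cast
  have h3 : (k:ℝ) + 1 + 1 = k + 2 := by ring
  rw [h3]
  linarith

lemma n_aseq_tendsto : Tendsto (fun n : ℕ => (n : ℝ) * aseq n) atTop (nhds (1 / 2)) := by
  have hl : Tendsto (fun n : ℕ => (1 / 2 : ℝ) * ((n:ℝ) / (n + 1))) atTop (nhds (1 / 2)) := by
    simpa using (tendsto_natCast_div_add_atTop (1:ℝ)).const_mul (1 / 2 : ℝ)
  refine tendsto_of_tendsto_of_tendsto_of_le_of_le' hl tendsto_const_nhds ?_ ?_
  · filter_upwards [eventually_gt_atTop 0] with n hn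
    calc (1 / 2 : ℝ) * ((n:ℝ) / (n + 1)) = n * (1 / (2 * (n + 1))) := by field_simp
      _ ≤ _ := by gcongr; exact le_aseq n hn
  · filter_upwards [eventually_gt_atTop 0] with n hn
    have hn' : (0:ℝ) < n := by exact_mod_cast hn
    calc (n : ℝ) * aseq n ≤ n * (1 / (2 * n)) := by gcongr; exact aseq_le n hn
      _ = _ := by field_simp

lemma exact_id (N : ℕ) (hN : 0 < N) :
    -π * ∑ j ∈ Finset.Icc 1 (N-1), ((j:ℝ)/N) * Real.cot (π * j / N)
          - N * Real.log N
          - (Real.eulerMascheroniConstant - Real.log (2*π)) * N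
      = N * trapezoidal_error phi N 0 1 + N * aseq N + 1 / 2 := by
  obtain ⟨M, rfl⟩ : ∃ k, N = k + 1 := ⟨N - 1, by omega⟩
  have hne : ((M + 1 : ℕ) : ℝ) ≠ 0 := by positivity
  have h1 : -π * ∑ j ∈ Finset.Icc 1 M, ((j:ℝ)/(M+1 : ℕ)) * Real.cot (π * j / (M+1 : ℕ))
      = ∑ k ∈ Finset.range M, phi (((k:ℝ) + 1) / (M + 1 : ℕ))
        + (M + 1 : ℕ) * (harmonic M : ℝ) := by
    have hh : (harmonic M : ℝ) = ∑ k ∈ Finset.range M, (((M:ℝ) - k))⁻¹ := by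
      rw [harmonic, ← Finset.sum_range_reflect]
      push_cast
      refine Finset.sum_congr rfl fun k hk => ?_
      rw [Finset.mem_range] at hk
      have : ((M - 1 - k : ℕ) : ℝ) = M - 1 - k := by
        rw [Nat.cast_sub (by omega), Nat.cast_sub (by omega)]; simp
      rw [this]; congr 1; ring
    rw [hh, Finset.mul_sum, Finset.mul_sum, ← Finset.sum_add_distrib, 
      ← Finset.Ico_add_one_right_eq_Icc, Finset.sum_Ico_eq_sum_range]
    refine Finset.sum_congr (by simp) fun k hk => ?_
    have hk' : (k:ℝ) < M := by
      have := Finset.mem_range.1 hk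
      exact_mod_cast (by omega : k < M)
    have hx1 : ((k:ℝ) + 1) / (M + 1 : ℕ) < 1 := by
      rw [div_lt_one (by positivity)]; push_cast; linarith
    have := phi_eq (x := ((k:ℝ) + 1) / (M + 1 : ℕ)) (by positivity) hx1
    have e : 1 / (1 - ((k:ℝ) + 1) / (M + 1 : ℕ)) = (M + 1 : ℕ) * ((M:ℝ) - k)⁻¹ := by
      have : (M:ℝ) - k ≠ 0 := by linarith
      have h3 : 1 - ((k:ℝ) + 1) / (M + 1 : ℕ) = ((M:ℝ) - k) / (M + 1 : ℕ) := by
        field_simp; push_cast; ring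
      rw [h3, one_div_div]; rfl
    rw [e] at this
    rw [← this]
    push_cast
    rw [add_comm (1:ℝ) k, mul_div_assoc]
  simp only [Nat.add_sub_cancel]
  rw [h1]
  unfold trapezoidal_error trapezoidal_integral aseq
  rw [integral_phi, phi_zero, phi_one, harmonic_succ]
  simp only [Nat.add_sub_cancel, zero_add, sub_zero, mul_one]
  push_cast at hne ⊢
  field_simp
  ring

/-- As `N → ∞`, `−π Σ_{j=1}^{N−1} (j/N)cot(πj/N) − N log N − (γ − log 2π)N → 1`. -/
theorem cot_sum_asymptotics :
    Tendsto (fun N : ℕ =>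
        -π * ∑ j ∈ Finset.Icc 1 (N-1), ((j:ℝ)/N) * Real.cot (π * j / N)
          - N * Real.log N
          - (Real.eulerMascheroniConstant - Real.log (2*π)) * N)
      atTop (nhds 1) := by
  have h := (trap_tendsto.add n_aseq_tendsto).add_const (1 / 2)
  norm_num only at h
  refine h.congr' ?_
  filter_upwards [eventually_gt_atTop 0] with N hN
  have := exact_id N hN
  linarith
end

section
/- For every integer N ≥ 2, −(Nπ/4)·Σ_{j=1}^{N−1} (j/N)·cot(πj/N) + 3N²/8 − 3N/8 ≤ (N²/4)·log N + (1/4)·( 3/2 − log(2π) + γ )·N². (Equivalently, the expected Riesz 2-energy of the zeros of a random elliptic polynomial mapped to the sphere is at most (N² log N)/4 + (1/4)(3/2 − log(2π) + γ)N².) -/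
open Real

noncomputable def rr (x : ℝ) : ℝ := π * Real.cot (π * x) - 1 / x + 1 / (1 - x)

noncomputable def pp (M : ℕ) (x : ℝ) : ℝ :=
  1 / (1 - x) + ∑ n ∈ Finset.range M, (1 / (x - (n + 1)) + 1 / (x + (n + 1)))

theorem pp_eq (M : ℕ) (x : ℝ) : pp (M+1) x =
    ∑ n ∈ Finset.range (M+1), 1 / (x + (n + 1)) + ∑ n ∈ Finset.range M, (-(1 / ((n:ℝ) + 2 - x))) := by
  have h : ∀ y : ℝ, 1 / (x - y) = - (1 / (y - x)) := by
    intro y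
    rw [← neg_sub y x, div_neg]
  unfold pp
  rw [Finset.sum_add_distrib, Finset.sum_range_succ' (fun n : ℕ => 1 / (x - ((n:ℝ) + 1)))]
  simp only [h]
  have : ∀ n : ℕ, ((n + 1 : ℕ) : ℝ) + 1 - x = (n:ℝ) + 2 - x := by intro n; push_cast; ring
  simp only [this]
  simp
  ring

theorem pp_anti (M : ℕ) {x y : ℝ} (hx : 0 ≤ x) (hxy : x ≤ y) (hy : y < 1) :
    pp (M+1) y ≤ pp (M+1) x := by
  rw [pp_eq, pp_eq]
  apply add_le_add
  · apply Finset.sum_le_sum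
    intro n _
    apply one_div_le_one_div_of_le (by positivity) (by linarith)
  · apply Finset.sum_le_sum
    intro n _
    have : (0:ℝ) ≤ n := by positivity
    apply neg_le_neg
    apply one_div_le_one_div_of_le (by linarith) (by linarith)

theorem pp_tendsto {x : ℝ} (hx : 0 ≤ x) (hx1 : x < 1) :
    Filter.Tendsto (fun M => pp M x) Filter.atTop (nhds (rr x)) := by
  rcases hx.eq_or_lt with rfl | hx
  · have : ∀ M, pp M 0 = rr 0 := by
      intro M
      simp [pp, rr, Real.cot_eq_cos_div_sin]
      apply Finset.sum_eq_zero
      intro n _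
      rw [← neg_add, inv_neg, add_comm (1:ℝ)]
      ring
    simp [this]
  · have hc : (x : ℂ) ∈ Complex.integerComplement := by
      rintro ⟨n, hn⟩
      have hn' : (n : ℝ) = x := by exact_mod_cast hn
      have h0 : (0:ℝ) < n := by linarith
      have h1 : (n:ℝ) < 1 := by linarith
      have h0' : 0 < n := by exact_mod_cast h0
      have h1' : n < 1 := by exact_mod_cast h1
      omega
    have h := (Complex.continuous_re.tendsto _).comp (tendsto_logDeriv_euler_cot_sub hc)
    have h2 := h.const_add (1 / (1 - x))
    have e1 : 1 / (1 - x) + (π * Complex.cot (π * x) - 1 / (x:ℂ)).re = rr x := by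
      have : (π * Complex.cot (π * x) - 1 / (x:ℂ)) = ((π * Real.cot (π * x) - 1 / x : ℝ) : ℂ) := by
        push_cast; rfl
      rw [this, Complex.ofReal_re, rr]; ring
    rw [e1] at h2
    refine h2.congr fun M => ?_
    have : (∑ j ∈ Finset.range M, cotTerm (x:ℂ) j)
      = ((∑ n ∈ Finset.range M, (1 / (x - (n + 1)) + 1 / (x + (n + 1))) : ℝ) : ℂ) := by
      push_cast; rfl
    simp only [Function.comp, this, Complex.ofReal_re, pp]

theorem rr_anti {x y : ℝ} (hx : 0 ≤ x) (hxy : x ≤ y) (hy : y < 1) : rr y ≤ rr x :=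
  le_of_tendsto_of_tendsto' ((pp_tendsto (hx.trans hxy) hy).comp (Filter.tendsto_add_atTop_nat 1))
    ((pp_tendsto hx (hxy.trans_lt hy)).comp (Filter.tendsto_add_atTop_nat 1))
    fun M => pp_anti M hx hxy hy

theorem rr_half : rr (1/2) = 0 := by
  have : π * (1/2) = π / 2 := by ring
  rw [rr, this, Real.cot_eq_cos_div_sin, Real.cos_pi_div_two]; norm_num

theorem cot_refl (x : ℝ) : Real.cot (π * (1 - x)) = - Real.cot (π * x) := by
  rw [mul_sub, mul_one, Real.cot_eq_cos_div_sin, Real.cot_eq_cos_div_sin, Real.cos_pi_sub,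
    Real.sin_pi_sub, neg_div]

theorem rr_refl (x : ℝ) : rr (1 - x) = - rr x := by
  rw [rr, rr, cot_refl]
  rw [sub_sub_cancel]; ring

noncomputable def ww (x : ℝ) : ℝ := (1/2 - x) * rr x

theorem ww_refl (x : ℝ) : ww (1 - x) = ww x := by
  rw [ww, ww, rr_refl]; ring

theorem rr_nonneg {x : ℝ} (hx : 0 ≤ x) (hx2 : x ≤ 1/2) : 0 ≤ rr x := by
  rw [← rr_half]; exact rr_anti hx hx2 (by norm_num)

theorem ww_nonneg {x : ℝ} (hx : 0 ≤ x) (hx2 : x ≤ 1/2) : 0 ≤ ww x :=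
  mul_nonneg (by linarith) (rr_nonneg hx hx2)

theorem ww_anti : AntitoneOn ww (Set.Icc 0 (1/2)) := by
  intro x hx y hy hxy
  exact mul_le_mul (by linarith) (rr_anti hx.1 hxy (by linarith [hy.2]))
    (rr_nonneg hy.1 hy.2) (by linarith [hx.2])

noncomputable def vv (x : ℝ) : ℝ := log (Real.sinc (π * x)) + log π - log (1 - x)

theorem sin_pos' {x : ℝ} (hx : 0 < x) (hx2 : x ≤ 1/2) : 0 < sin (π * x) := by
  apply Real.sin_pos_of_pos_of_lt_pi (by positivity)
  nlinarith [Real.pi_pos]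

theorem vv_eq {x : ℝ} (hx : 0 < x) (hx2 : x ≤ 1/2) :
    vv x = log (sin (π * x)) - log x - log (1 - x) := by
  have := sin_pos' hx hx2
  rw [vv, Real.sinc_of_ne_zero (by positivity), Real.log_div (by positivity) (by positivity),
    Real.log_mul (by positivity) (by positivity)]
  ring

theorem vv_cont : ContinuousOn vv (Set.uIcc 0 (1/2)) := by
  rw [Set.uIcc_of_le (by norm_num)]
  unfold vv
  refine ContinuousOn.sub (ContinuousOn.add (ContinuousOn.log ?_ ?_) continuousOn_const)
    (ContinuousOn.log (by fun_prop) ?_)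
  · exact (Real.continuous_sinc.comp (by fun_prop : Continuous fun x : ℝ => π * x)).continuousOn
  · intro x hx
    rcases hx.1.eq_or_lt with rfl | h
    · simp
    · have := sin_pos' h hx.2
      rw [Real.sinc_of_ne_zero (by positivity)]
      positivity
  · intro x hx
    have := hx.2
    linarith

theorem vv_deriv {x : ℝ} (hx : 0 < x) (hx2 : x < 1/2) : HasDerivAt vv (rr x) x := by
  have hs := sin_pos' hx hx2.le
  have h1 : HasDerivAt (fun x : ℝ => log (sin (π * x)) - log x - log (1 - x)) (rr x) x := by
    have a : HasDerivAt (fun x : ℝ => π * x) π x := by simpa using (hasDerivAt_id x).const_mul π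
    have b : HasDerivAt (fun x : ℝ => 1 - x) (-1) x := by simpa using (hasDerivAt_id x).const_sub 1
    have := ((a.sin.log hs.ne').sub (Real.hasDerivAt_log hx.ne')).sub (b.log (by linarith))
    have e : rr x = cos (π * x) * π / sin (π * x) - x⁻¹ - -1 / (1 - x) := by
      rw [rr, Real.cot_eq_cos_div_sin]
      ring
    rw [e]
    exact this
  apply h1.congr_of_eventuallyEq
  filter_upwards [Ioo_mem_nhds hx hx2] with y hy
  exact vv_eq hy.1 hy.2.le

theorem vv_int : ∫ x in (0:ℝ)..(1/2), vv x = 1 - log 2 / 2 := by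
  have h1 : ∫ x in (0:ℝ)..(1/2), vv x
      = ∫ x in (0:ℝ)..(1/2), (log (sin (π * x)) - log x - log (1 - x)) := by
    apply intervalIntegral.integral_congr_ae
    filter_upwards with x hx
    rw [Set.uIoc_of_le (by norm_num)] at hx
    exact vv_eq hx.1 hx.2
  have i1 : IntervalIntegrable (fun x => log (sin (π * x))) MeasureTheory.volume 0 (1/2) := by
    have := (intervalIntegrable_log_sin (a := 0) (b := π/2)).comp_mul_left (c := π)
    have e : π / 2 / π = 1/2 := by field_simp
    simpa [e] using this
  have i2 : IntervalIntegrable (fun x => log x) MeasureTheory.volume 0 (1/2) :=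
    intervalIntegral.intervalIntegrable_log'
  have i3 : IntervalIntegrable (fun x => log (1 - x)) MeasureTheory.volume 0 (1/2) := by
    have := (intervalIntegral.intervalIntegrable_log' (a := 1) (b := 1/2)).comp_sub_left 1
    norm_num at this
    simpa using this
  rw [h1, intervalIntegral.integral_sub (i1.sub i2) i3, intervalIntegral.integral_sub i1 i2,
    intervalIntegral.integral_comp_mul_left (fun x => log (sin x)) Real.pi_pos.ne',
    intervalIntegral.integral_comp_sub_left (fun x => log x), integral_log, integral_log]
  have e : π * (1/2) = π / 2 := by ring
  rw [mul_zero, e, integral_log_sin_zero_pi_div_two]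
  have : (1:ℝ) - 1/2 = 1/2 := by norm_num
  rw [this]
  have := Real.pi_pos.ne'
  simp only [smul_eq_mul, sub_zero, Real.log_one]
  field_simp
  ring

theorem ww_int : ∫ x in (0:ℝ)..(1/2), ww x = 1 - log (2 * π) / 2 := by
  have hr : IntervalIntegrable rr MeasureTheory.volume 0 (1/2) := by
    apply AntitoneOn.intervalIntegrable
    rw [Set.uIcc_of_le (by norm_num)]
    intro x hx y hy hxy
    exact rr_anti hx.1 hxy (by linarith [hy.2])
  have := intervalIntegral.integral_mul_deriv_eq_deriv_mul_of_hasDerivAt (a := 0) (b := 1/2)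
    (u := fun x : ℝ => 1/2 - x) (u' := fun _ => -1) (v := vv) (v' := rr) (by fun_prop) vv_cont
    (fun x _ => (hasDerivAt_id x).const_sub (1/2))
    (fun x hx => by
      rw [min_eq_left (by norm_num), max_eq_right (by norm_num)] at hx
      exact vv_deriv hx.1 hx.2) (by simp) hr
  have e : ∫ x in (0:ℝ)..(1/2), ww x = ∫ x in (0:ℝ)..(1/2), (1/2 - x) * rr x := rfl
  rw [e, this, intervalIntegral.integral_const_mul, vv_int]
  have : vv 0 = log π := by simp [vv]
  rw [this, Real.log_mul (by norm_num) Real.pi_pos.ne']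
  ring

theorem ww_sum_half (N : ℕ) (hN : 0 < N) (a : ℕ) (ha : 2 * a ≤ N) :
    ∑ i ∈ Finset.range a, ww (((i + 1 : ℕ) : ℝ) / N) ≤ N * (1 - log (2 * π) / 2) := by
  have hN' : (0:ℝ) < N := by exact_mod_cast hN
  have ha' : 2 * (a:ℝ) ≤ N := by exact_mod_cast ha
  have ha2 : (a:ℝ) / N ≤ 1/2 := by
    rw [div_le_div_iff₀ hN' (by norm_num)]; linarith
  have h := AntitoneOn.sum_le_integral (x₀ := 0) (a := a) (f := fun t => ww (t / N)) (by
    intro x hx y hy hxy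
    rw [zero_add] at hx hy
    have k : ∀ z ∈ Set.Icc (0:ℝ) a, z / N ∈ Set.Icc (0:ℝ) (1/2) := fun z hz =>
      ⟨div_nonneg hz.1 hN'.le, le_trans (by gcongr; exact hz.2) ha2⟩
    exact ww_anti (k x hx) (k y hy) (by gcongr))
  simp only [zero_add] at h
  refine h.trans ?_
  rw [intervalIntegral.integral_comp_div _ hN'.ne', ← ww_int, smul_eq_mul, zero_div]
  gcongr
  have hi : IntervalIntegrable ww MeasureTheory.volume 0 (1/2) := by
    apply AntitoneOn.intervalIntegrable
    rw [Set.uIcc_of_le (by norm_num)]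
    exact ww_anti
  apply intervalIntegral.integral_mono_interval le_rfl (by positivity) ha2 _ hi
  rw [Filter.EventuallyLE, MeasureTheory.ae_restrict_iff' measurableSet_Ioc]
  filter_upwards with x hx
  exact ww_nonneg hx.1.le hx.2

theorem sum_refl (N : ℕ) (f : ℕ → ℝ) :
    ∑ j ∈ Finset.Icc 1 (N-1), f (N - j) = ∑ j ∈ Finset.Icc 1 (N-1), f j := by
  apply Finset.sum_nbij' (fun j => N - j) (fun j => N - j) <;>
    simp only [Finset.mem_Icc] <;> intros <;> first | omega | trivial

theorem ww_sum (N : ℕ) (hN : 2 ≤ N) :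
    ∑ j ∈ Finset.Icc 1 (N-1), ww ((j:ℝ) / N) ≤ N * (2 - log (2 * π)) := by
  have hN' : (0:ℝ) < N := by exact_mod_cast (by omega : 0 < N)
  set a := (N - 1) / 2 with ha
  have h1 : ∑ j ∈ Finset.Icc 1 a, ww ((j:ℝ) / N) = ∑ i ∈ Finset.range a, ww (((i + 1 : ℕ) : ℝ) / N) := by
    rw [Finset.range_eq_Ico, Finset.sum_Ico_add' (fun i : ℕ => ww ((i:ℝ)/N)) 0 a 1]
    congr 1
  have h2 : ∑ j ∈ Finset.Icc (N-a) (N-1), ww ((j:ℝ) / N) = ∑ j ∈ Finset.Icc 1 a, ww ((j:ℝ) / N) := by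
    apply Finset.sum_nbij' (fun j => N - j) (fun j => N - j)
    · simp only [Finset.mem_Icc]; intros; omega
    · simp only [Finset.mem_Icc]; intros; omega
    · simp only [Finset.mem_Icc]; intros; omega
    · simp only [Finset.mem_Icc]; intros; omega
    · intro j hj
      simp only [Finset.mem_Icc] at hj
      rw [Nat.cast_sub (by omega), sub_div, div_self hN'.ne', ww_refl]
  have h3 : ∑ j ∈ Finset.Icc 1 (N-1), ww ((j:ℝ) / N)
      = ∑ j ∈ Finset.Icc 1 a ∪ Finset.Icc (N-a) (N-1), ww ((j:ℝ) / N) := by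
    symm
    apply Finset.sum_subset
    · intro j; simp only [Finset.mem_union, Finset.mem_Icc]; omega
    · intro j hj hj'
      simp only [Finset.mem_union, Finset.mem_Icc] at hj hj'
      have : N = 2 * j := by omega
      have hj0 : (0:ℝ) < j := by exact_mod_cast hj.1
      have : (j:ℝ) / N = 1/2 := by rw [this]; push_cast; field_simp
      rw [this, ww]; simp
  rw [h3, Finset.sum_union, h2, h1]
  · have := ww_sum_half N (by omega) a (by omega)
    linarith
  · rw [Finset.disjoint_left]; intro j; simp only [Finset.mem_Icc]; omega

theorem harm_bound (N : ℕ) (hN : 1 ≤ N) :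
    (harmonic N : ℝ) ≤ log N + eulerMascheroniConstant + 1 / (2 * N) := by
  let f : ℕ → ℝ := fun n => (harmonic (n+1) : ℝ) - log ((n+1 : ℕ):ℝ) - 1 / (2 * ((n+1 : ℕ):ℝ))
  have hm : Monotone f := by
    apply monotone_nat_of_le_succ
    intro n
    have hp : (0:ℝ) < n + 1 := by positivity
    have hy : (1:ℝ) ≤ (n + 2) / (n + 1) := by rw [le_div_iff₀ hp]; linarith
    have h := Real.self_le_sinh_iff.2 (Real.log_nonneg hy)
    rw [Real.sinh_log (by positivity), Real.log_div (by positivity) (by positivity)] at h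
    simp only [f]
    rw [harmonic_succ (n+1)]
    push_cast
    have e : (n:ℝ) + 1 + 1 = n + 2 := by ring
    rw [e]
    have e2 : (((n:ℝ) + 2) / (n + 1) - (((n:ℝ) + 2) / (n + 1))⁻¹) / 2
      = ((n:ℝ)+2)⁻¹ - 1 / (2 * (n+2)) + 1 / (2 * (n + 1)) := by
      field_simp; ring
    linarith
  have ht : Filter.Tendsto f Filter.atTop (nhds eulerMascheroniConstant) := by
    have a := tendsto_harmonic_sub_log.comp (Filter.tendsto_add_atTop_nat 1)
    have b : Filter.Tendsto (fun n : ℕ => 1 / (2 * ((n+1 : ℕ):ℝ))) Filter.atTop (nhds 0) := by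
      have := (tendsto_one_div_add_atTop_nhds_zero_nat (𝕜 := ℝ)).const_mul (1/2)
      rw [mul_zero] at this
      refine this.congr fun n => ?_
      push_cast; field_simp
    rw [← sub_zero eulerMascheroniConstant]
    exact a.sub b
  have := hm.ge_of_tendsto ht (N - 1)
  simp only [f] at this
  rw [Nat.sub_add_cancel hN] at this
  linarith

theorem expected_riesz_two_energy_bound (N : ℕ) (hN : 2 ≤ N) :
    -((N:ℝ) * π / 4) * ∑ j ∈ Finset.Icc 1 (N-1), ((j:ℝ)/N) * Real.cot (π * j / N)
        + 3*(N:ℝ)^2/8 - 3*(N:ℝ)/8 ≤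
      (N:ℝ)^2/4 * Real.log N
        + (1/4) * (3/2 - Real.log (2*π) + Real.eulerMascheroniConstant) * (N:ℝ)^2 := by
  have hN' : (0:ℝ) < N := by exact_mod_cast (by omega : 0 < N)
  set S := ∑ j ∈ Finset.Icc 1 (N-1), ((j:ℝ)/N) * Real.cot (π * j / N) with hS
  have hc : ∑ j ∈ Finset.Icc 1 (N-1), Real.cot (π * j / N) = 0 := by
    have h1 := sum_refl N (fun j => Real.cot (π * j / N))
    have h2 : ∑ j ∈ Finset.Icc 1 (N-1), Real.cot (π * (N - j : ℕ) / N)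
        = - ∑ j ∈ Finset.Icc 1 (N-1), Real.cot (π * j / N) := by
      rw [← Finset.sum_neg_distrib]
      apply Finset.sum_congr rfl
      intro j hj
      simp only [Finset.mem_Icc] at hj
      rw [mul_div_assoc, mul_div_assoc, ← cot_refl, Nat.cast_sub (by omega), sub_div,
        div_self hN'.ne']
    linarith
  have hH : ∑ j ∈ Finset.Icc 1 (N-1), ((N:ℝ) / j) = N * ((harmonic N : ℝ) - 1 / N) := by
    have : (harmonic N : ℝ) = harmonic (N - 1) + 1 / N := by
      obtain ⟨m, rfl⟩ : ∃ m, N = m + 1 := ⟨N - 1, by omega⟩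
      rw [harmonic_succ]; simp
    rw [this, add_sub_cancel_right, harmonic_eq_sum_Icc]
    push_cast
    rw [Finset.mul_sum]; rfl
  have hH2 : ∑ j ∈ Finset.Icc 1 (N-1), ((N:ℝ) / (N - j)) = N * ((harmonic N : ℝ) - 1 / N) := by
    rw [← hH, ← sum_refl N (fun j => (N:ℝ) / j)]
    apply Finset.sum_congr rfl
    intro j hj
    simp only [Finset.mem_Icc] at hj
    rw [Nat.cast_sub (by omega)]
  have hw : ∑ j ∈ Finset.Icc 1 (N-1), ww ((j:ℝ)/N) = -π * S + 2 * ((N:ℝ) - 1) - N * ((harmonic N : ℝ) - 1 / N) := by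
    have hterm : ∀ j ∈ Finset.Icc 1 (N-1), ww ((j:ℝ)/N) =
        (π / 2) * Real.cot (π * j / N) + (-π) * (((j:ℝ)/N) * Real.cot (π * j / N)) + 2
         + (-1/2) * ((N:ℝ) / j) + (-1/2) * ((N:ℝ) / (N - j)) := by
      intro j hj
      simp only [Finset.mem_Icc] at hj
      have h0 : (0:ℝ) < j := by exact_mod_cast hj.1
      have h1 : (0:ℝ) < N - j := by
        have : (j:ℝ) < N := by exact_mod_cast (by omega : j < N)
        linarith
      rw [ww, rr, ← mul_div_assoc]
      have e : 1 - (j:ℝ)/N = (N - j) / N := by field_simp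
      rw [e]
      generalize Real.cot (π * j / N) = c
      field_simp
      ring
    rw [Finset.sum_congr rfl hterm]
    simp only [Finset.sum_add_distrib, ← Finset.mul_sum]
    rw [hc, hH, hH2, ← hS]
    simp only [Finset.sum_const, Nat.card_Icc, nsmul_eq_mul]
    rw [Nat.add_sub_cancel, Nat.cast_sub (by omega)]
    push_cast
    ring
  have hb := ww_sum N hN
  have hh := harm_bound N (by omega)
  rw [hw] at hb
  have key : -π * S ≤ N * (log N + eulerMascheroniConstant - log (2 * π)) + 3 / 2 := by
    have := mul_le_mul_of_nonneg_left hh hN'.le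
    have e1 : (N:ℝ) * (1 / (2 * N)) = 1/2 := by field_simp
    have e2 : (N:ℝ) * (1 / N) = 1 := by field_simp
    nlinarith
  have := mul_le_mul_of_nonneg_left key (by positivity : 0 ≤ (N:ℝ)/4)
  linarith
end
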